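/- Suppose ρ is a reduced word and ρxy is also reduced for positive integers x and y. Let c_x be the column of the box in P̂(ρx) \ P̂(ρ) and let c_y be the column of the box in P̂(ρxy) \ P̂(ρx), where P̂ is the weak Edelman–Greene insertion tableau. Then x < y if and only if c_x < c_y. -/

import Mathlib

noncomputable section
attribute [local instance] Classical.propDecidable

/-! ### Words, permutations, reduced words -/

/-- The adjacent transposition `s_i` exchanging `i` and `i+1`. -/
def sPerm (i : ℕ) : Equiv.Perm ℕ := Equiv.swap i (i + 1)

/-- The permutation `s_{i_1} ⋯ s_{i_n}` represented by the word `i_1 ⋯ i_n`. -/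
def wordPerm (ρ : List ℕ) : Equiv.Perm ℕ := (ρ.map sPerm).prod

/-- A word whose letters are positive integers. -/
def PosWord (ρ : List ℕ) : Prop := ∀ x ∈ ρ, 1 ≤ x

/-- A reduced word: a word of positive integers of minimal length among all words of
positive integers representing the same permutation. -/
def IsReducedWord (ρ : List ℕ) : Prop :=
  PosWord ρ ∧ ∀ σ : List ℕ, PosWord σ → wordPerm σ = wordPerm ρ → ρ.length ≤ σ.length

/-- `ρ` is a reduced word for the permutation `w`. -/
def IsReducedWordFor (w : Equiv.Perm ℕ) (ρ : List ℕ) : Prop :=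
  IsReducedWord ρ ∧ wordPerm ρ = w

/-- A member of `S∞`: a permutation of the positive integers (it fixes `0`)
fixing all but finitely many points. -/
def FinitaryPerm (w : Equiv.Perm ℕ) : Prop := w 0 = 0 ∧ {i : ℕ | w i ≠ i}.Finite

/-- A flag: a weakly increasing function `φ : ℤ_{>0} → ℤ_{>0}` with `φ(n) ≥ n`. -/
def IsFlag (φ : ℕ → ℕ) : Prop :=
  (∀ m n : ℕ, 1 ≤ m → m ≤ n → φ m ≤ φ n) ∧ ∀ n : ℕ, 1 ≤ n → n ≤ φ n

/-- A weak composition, as a function on the positive integers (value `0` at `0`)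
with finitely many nonzero entries. -/
def WeakComp (α : ℕ → ℕ) : Prop := α 0 = 0 ∧ {i : ℕ | α i ≠ 0}.Finite

/-- `φ - e_i`, i.e. `l ↦ φ(l) - δ_{il}`. -/
def subE (φ : ℕ → ℕ) (i : ℕ) : ℕ → ℕ := fun l => if l = i then φ l - 1 else φ l

/-- The right action of `s_i` on weak compositions, swapping entries `i` and `i+1`. -/
def swapC (α : ℕ → ℕ) (i : ℕ) : ℕ → ℕ := fun j => α (sPerm i j)

/-- `α` has length `k`: `k` is minimal with `α i = 0` for all `i > k`. -/
def HasLen (α : ℕ → ℕ) (k : ℕ) : Prop :=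
  (∀ i, k < i → α i = 0) ∧ ∀ m, (∀ i, m < i → α i = 0) → k ≤ m

/-! ### Coxeter–Knuth equivalence -/

/-- One Coxeter–Knuth move. -/
def CKStep (u v : List ℕ) : Prop :=
  (∃ (a b : List ℕ) (x y z : ℕ), y < x ∧ x < z ∧
      u = a ++ [x, y, z] ++ b ∧ v = a ++ [x, z, y] ++ b) ∨
  (∃ (a b : List ℕ) (x y z : ℕ), y < z ∧ z < x ∧
      u = a ++ [x, y, z] ++ b ∧ v = a ++ [y, x, z] ++ b) ∨
  (∃ (a b : List ℕ) (i : ℕ),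
      u = a ++ [i, i + 1, i] ++ b ∧ v = a ++ [i + 1, i, i + 1] ++ b)

/-- Coxeter–Knuth equivalence: the transitive (symmetric, reflexive) closure of `CKStep`. -/
def CKEquiv : List ℕ → List ℕ → Prop := Relation.EqvGen CKStep

/-! ### Run factorizations and weak descent tableaux -/

/-- The run factorization of a word into maximal strictly increasing blocks
(listed from left to right). -/
def runFact : List ℕ → List (List ℕ)
  | [] => []
  | a :: rest =>
    match runFact rest with
    | [] => [[a]]
    | r :: rs => if a < r.headI then (a :: r) :: rs else [a] :: r :: rs

/-- Auxiliary: rows of the remaining blocks, given the row of the previous block. -/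
def wdtRowsAux : ℤ → List (List ℕ) → List ℤ
  | _, [] => []
  | prev, b :: bs =>
      min (prev - 1) (b.headI : ℤ) :: wdtRowsAux (min (prev - 1) (b.headI : ℤ)) bs

/-- The row indices assigned to the blocks of a run factorization (blocks listed
left to right): the leftmost block goes to the row indexed by its first letter, and each
subsequent block goes to the row indexed by its first letter if this is below the previous
block's row, and otherwise directly below the previous block's row. -/
def wdtRows : List (List ℕ) → List ℤ
  | [] => []
  | b :: bs => (b.headI : ℤ) :: wdtRowsAux (b.headI : ℤ) bs

/-- A tableau: rows indexed by `ℤ` (bottom to top), columns indexed by `ℕ` starting at `1`;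
the value `0` means that there is no box, a nonzero value is the (positive) entry. -/
abbrev Tableau := ℤ → ℕ → ℕ

/-- The weak descent tableau of a word. -/
def weakDesTab (ρ : List ℕ) : Tableau := fun r c =>
  if c = 0 then 0
  else
    match ((wdtRows (runFact ρ)).zip (runFact ρ)).find? (fun p => decide (p.1 = r)) with
    | some p => p.2.getD (c - 1) 0
    | none => 0

/-- A word is non-virtual if its weak descent tableau only occupies rows of positive index. -/
def NonVirtual (ρ : List ℕ) : Prop := ∀ r ∈ wdtRows (runFact ρ), 1 ≤ r

/-- The shape of a tableau: the number of boxes in each (positively indexed) row. -/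
def shapeOf (T : Tableau) : ℕ → ℕ := fun i => Set.ncard {c : ℕ | T (i : ℤ) c ≠ 0}

/-- The weak descent composition of a word: the shape of its weak descent tableau. -/
def desComp (ρ : List ℕ) : ℕ → ℕ := shapeOf (weakDesTab ρ)

/-- Partial-sum (dominance) order on weak compositions. -/
def compLE (μ ν : ℕ → ℕ) : Prop :=
  ∀ k : ℕ, ∑ i ∈ Finset.Icc 1 k, μ i ≤ ∑ i ∈ Finset.Icc 1 k, ν i

/-- A Yamanouchi reduced word: a non-virtual reduced word that is minimal in its
Coxeter–Knuth class among non-virtual words, for the order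
`ρ ≤ τ ↔ ρ ~ τ ∧ des ρ ≤ des τ`. -/
def Yamanouchi (ρ : List ℕ) : Prop :=
  IsReducedWord ρ ∧ NonVirtual ρ ∧
    ∀ σ : List ℕ, NonVirtual σ → CKEquiv ρ σ → compLE (desComp ρ) (desComp σ)

/-- The (unique) Yamanouchi reduced word Coxeter–Knuth equivalent to `ρ`. -/
def hatRho (ρ : List ℕ) : List ℕ :=
  if h : ∃ σ, Yamanouchi σ ∧ CKEquiv ρ σ then h.choose else []

/-- The weak Edelman–Greene insertion tableau of a word: the weak descent tableau of the
unique Yamanouchi reduced word Coxeter–Knuth equivalent to it. -/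
def hatP (ρ : List ℕ) : Tableau := weakDesTab (hatRho ρ)

/-! ### Factorizations -/

/-- The factorization `f : ℕ → List ℕ` stores the block `ρ^{(i)}` at index `i ≥ 1`
(blocks indexed from the right); the largest index of a nonempty block. -/
def topIdx (f : ℕ → List ℕ) : ℕ := sSup {i : ℕ | f i ≠ []}

/-- The concatenation `ρ^{(top)} ⋯ ρ^{(i+1)} ρ^{(i)}` of the blocks of `f` with index `≥ i`. -/
def factWordGe (f : ℕ → List ℕ) (i : ℕ) : List ℕ :=
  ((((List.range (topIdx f + 1)).reverse).filter (fun j => decide (i ≤ j))).map f).foldr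
    (· ++ ·) []

/-- The underlying word of a factorization. -/
def factWord (f : ℕ → List ℕ) : List ℕ := factWordGe f 0

/-- The weak Edelman–Greene recording tableau of a factorization: it has the same shape as
the weak EG insertion tableau of the underlying word, and has entry `i` in all boxes of
`P̂(ρ^{(k)}|⋯|ρ^{(i)})` that are not in `P̂(ρ^{(k)}|⋯|ρ^{(i+1)})`. -/
def hatQfact (f : ℕ → List ℕ) : Tableau := fun r c =>
  sSup {i : ℕ | 1 ≤ i ∧ hatP (factWordGe f i) r c ≠ 0 ∧ hatP (factWordGe f (i + 1)) r c = 0}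

/-- Every block is strictly increasing. -/
def IncreasingFact (f : ℕ → List ℕ) : Prop := ∀ i, List.Chain' (· < ·) (f i)

/-- The factorization is `φ`-flagged: every nonempty block `ρ^{(i)}` has first letter
`ρ^{(i)}_1` with `φ(ρ^{(i)}_1) ≥ i`. -/
def FlaggedFact (φ : ℕ → ℕ) (f : ℕ → List ℕ) : Prop :=
  ∀ i, f i ≠ [] → i ≤ φ ((f i).headI)

/-- `RFC(w, φ)`: all `φ`-flagged increasing factorizations of reduced words for `w`. -/
def RFCset (w : Equiv.Perm ℕ) (φ : ℕ → ℕ) : Set (ℕ → List ℕ) :=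
  {f | f 0 = [] ∧ {i : ℕ | f i ≠ []}.Finite ∧ IncreasingFact f ∧ FlaggedFact φ f ∧
       IsReducedWordFor w (factWord f)}

/-- `RF_n(w)`: increasing factorizations of reduced words for `w` with exactly `n` blocks
(indexed `1, …, n`, possibly empty). -/
def RFn (n : ℕ) (w : Equiv.Perm ℕ) : Set (ℕ → List ℕ) :=
  {f | f 0 = [] ∧ (∀ j, n < j → f j = []) ∧ IncreasingFact f ∧
       IsReducedWordFor w (factWord f)}

/-- `RFC_n(w, φ)`: the `φ`-flagged elements of `RF_n(w)`. -/
def RFCn (n : ℕ) (w : Equiv.Perm ℕ) (φ : ℕ → ℕ) : Set (ℕ → List ℕ) :=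
  {f | f ∈ RFn n w ∧ FlaggedFact φ f}

/-! ### Morse–Schilling crystal operators -/

/-- Pairing procedure: first argument is the block `r^{(i)}` in *decreasing* order, second is
the not-yet-paired part of the block `r^{(i+1)}` (in increasing order). Each letter `b` of
`r^{(i)}`, from largest to smallest, is paired with the smallest still unpaired letter of
`r^{(i+1)}` strictly larger than `b`. Returns the unpaired letters of `r^{(i+1)}`. -/
def unpairedUpper : List ℕ → List ℕ → List ℕ
  | [], A => A
  | b :: bs, A =>
    match A.find? (fun a => decide (b < a)) with
    | some a => unpairedUpper bs (A.erase a)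
    | none => unpairedUpper bs A

/-- As in `unpairedUpper`, but returns the unpaired letters of `r^{(i)}`. -/
def unpairedLower : List ℕ → List ℕ → List ℕ
  | [], _ => []
  | b :: bs, A =>
    match A.find? (fun a => decide (b < a)) with
    | some a => unpairedLower bs (A.erase a)
    | none => b :: unpairedLower bs A

/-- Insert a letter into a weakly increasing list, keeping it increasing. -/
def insAsc (x : ℕ) : List ℕ → List ℕ
  | [] => [x]
  | y :: ys => if x ≤ y then x :: y :: ys else y :: insAsc x ys

/-- The Morse–Schilling raising operator `e_i`: if every letter of block `i+1` is paired,
the result is `none` (i.e. `0`); otherwise the largest unpaired letter `a` of block `i+1` is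
removed and `a + s` is added to block `i`, where `s = min {j ≥ 0 | a+j+1 ∉ r^{(i+1)}}`. -/
def msE (i : ℕ) (f : ℕ → List ℕ) : Option (ℕ → List ℕ) :=
  let B := f i
  let A := f (i + 1)
  let L := unpairedUpper B.reverse A
  if L = [] then none
  else
    let a := L.foldr max 0
    let s := sInf {j : ℕ | (a + j + 1) ∉ A}
    some (Function.update (Function.update f (i + 1) (A.erase a)) i (insAsc (a + s) B))

/-- The Morse–Schilling lowering operator `f_i`: if every letter of block `i` is paired,
the result is `none`; otherwise the smallest unpaired letter `b` of block `i` is removed and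
`b - t` is added to block `i+1`, where `t = min {j ≥ 0 | b-j-1 ∉ r^{(i)}}`. -/
def msF (i : ℕ) (f : ℕ → List ℕ) : Option (ℕ → List ℕ) :=
  let B := f i
  let A := f (i + 1)
  let R := unpairedLower B.reverse A
  if R = [] then none
  else
    let b := R.foldr min R.headI
    let t := sInf {j : ℕ | (b - j - 1) ∉ B}
    some (Function.update (Function.update f i (B.erase b)) (i + 1) (insAsc (b - t) A))

/-- Iteration `e_j^k` of the raising operator. -/
def msEIter (j : ℕ) : ℕ → (ℕ → List ℕ) → Option (ℕ → List ℕ)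
  | 0, f => some f
  | k + 1, f => (msE j f).bind (msEIter j k)

/-- The Demazure operator `𝔇_j` on subsets of the crystal `RF_n(w)`:
`𝔇_j X = {b ∈ RF_n(w) | e_j^k(b) ∈ X for some k ≥ 0}`. -/
def demOp (n : ℕ) (w : Equiv.Perm ℕ) (j : ℕ) (X : Set (ℕ → List ℕ)) : Set (ℕ → List ℕ) :=
  {b | b ∈ RFn n w ∧ ∃ (k : ℕ) (c : ℕ → List ℕ), msEIter j k b = some c ∧ c ∈ X}

/-- `𝔇_{i_1} 𝔇_{i_2} ⋯ 𝔇_{i_k} X` for a word `i_1 i_2 ⋯ i_k` (the head is applied last). -/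
def demWord (n : ℕ) (w : Equiv.Perm ℕ) : List ℕ → Set (ℕ → List ℕ) → Set (ℕ → List ℕ)
  | [], X => X
  | j :: rest, X => demOp n w j (demWord n w rest X)

/-- `𝔇_{b↓a} = 𝔇_{b-1} 𝔇_{b-2} ⋯ 𝔇_a` (the identity when `b ≤ a`). -/
def demDown (n : ℕ) (w : Equiv.Perm ℕ) (b a : ℕ) (X : Set (ℕ → List ℕ)) :
    Set (ℕ → List ℕ) :=
  demWord n w ((List.range' a (b - a)).reverse) X

/-! ### Key tableaux -/

/-- A key tableau: a filling of a left-justified diagram in the positively indexed rows,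
with positive entries, weakly decreasing rows, distinct column entries, and the key
condition (c) of Assaf–Schilling. -/
def IsKeyTableau (T : Tableau) : Prop :=
  (∀ (r : ℤ) (c : ℕ), r ≤ 0 → T r c = 0) ∧
  (∀ r : ℤ, T r 0 = 0) ∧
  {p : ℤ × ℕ | T p.1 p.2 ≠ 0}.Finite ∧
  (∀ (r : ℤ) (c : ℕ), 1 ≤ c → T r (c + 1) ≠ 0 → T r c ≠ 0) ∧
  (∀ (r : ℤ) (c : ℕ), 1 ≤ c → T r (c + 1) ≠ 0 → T r (c + 1) ≤ T r c) ∧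
  (∀ (r r' : ℤ) (c : ℕ), r ≠ r' → T r c ≠ 0 → T r' c ≠ 0 → T r c ≠ T r' c) ∧
  (∀ (r r' : ℤ) (c : ℕ), r < r' → T r c ≠ 0 → T r' c ≠ 0 → T r' c < T r c →
      T r (c + 1) ≠ 0 ∧ T r' c < T r (c + 1))

/-- The tableau is `φ`-flagged: every entry in row `i` is at most `φ(i)`. -/
def FlaggedTab (φ : ℕ → ℕ) (T : Tableau) : Prop := ∀ (i c : ℕ), T (i : ℤ) c ≤ φ i

/-- `SSKT(α, φ)`: the `φ`-flagged key tableaux of shape `α`. -/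
def SSKT (α φ : ℕ → ℕ) : Set Tableau :=
  {T | IsKeyTableau T ∧ shapeOf T = α ∧ FlaggedTab φ T}

/-- The weight of a tableau: `wt(T)_v` is the number of entries equal to `v`. -/
def wtTab (T : Tableau) : ℕ → ℕ := fun v =>
  if v = 0 then 0 else Set.ncard {p : ℤ × ℕ | T p.1 p.2 = v}

/-- The weight of a word: the multiplicity of each positive letter. -/
def wtWord (u : List ℕ) : ℕ → ℕ := fun v => if v = 0 then 0 else u.count v

/-- The statistic `m_i(col(T), j)` where position `j` of the reverse column reading word
(entries read down columns, from right to left) is the box in row `r`, column `c`: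
the number of entries `i+1` weakly after this box minus the number of entries `i`. -/
def mi (T : Tableau) (i : ℕ) (r : ℤ) (c : ℕ) : ℤ :=
  (Set.ncard {p : ℤ × ℕ | T p.1 p.2 = i + 1 ∧ (p.2 < c ∨ (p.2 = c ∧ p.1 ≤ r))} : ℤ) -
  (Set.ncard {p : ℤ × ℕ | T p.1 p.2 = i ∧ (p.2 < c ∨ (p.2 = c ∧ p.1 ≤ r))} : ℤ)

/-- The box `(r, c)` maximizes `m_i` among all boxes of `T`. -/
def isMaxBox (T : Tableau) (i : ℕ) (r : ℤ) (c : ℕ) : Prop :=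
  T r c ≠ 0 ∧ ∀ (r' : ℤ) (c' : ℕ), T r' c' ≠ 0 → mi T i r' c' ≤ mi T i r c

/-- The Assaf–Schilling raising operator `e_i` on key tableaux.  If `m_i(col(T)) ≤ 0` the
result is `none` (i.e. `0`); otherwise, with `q` the largest position of the reverse column
reading word achieving the maximum (i.e. the maximizing box with the smallest column index,
and the smallest row index in that column), all entries `i+1` in the row of `q` weakly to its
right are changed to `i`, and all entries `i` in the same columns as these entries are
changed to `i+1`. -/
def keyE (i : ℕ) (T : Tableau) : Option Tableau :=
  if h : ∃ (r : ℤ) (c : ℕ), isMaxBox T i r c ∧ 1 ≤ mi T i r c then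
    let cq := sInf {c : ℕ | ∃ r : ℤ, isMaxBox T i r c}
    let rq : ℤ := ((sInf {m : ℕ | isMaxBox T i ((m : ℕ) : ℤ) cq} : ℕ) : ℤ)
    some (fun r c =>
      if cq ≤ c ∧ T rq c = i + 1 then
        (if T r c = i + 1 then i else if T r c = i then i + 1 else T r c)
      else T r c)
  else none

/-- The Assaf–Schilling lowering operator `f_i`: the (unique) inverse of `e_i`. -/
def keyF (i : ℕ) (T : Tableau) : Option Tableau :=
  if h : ∃ T', keyE i T' = some T then some h.choose else none

/-- Restriction of a partially defined crystal operator to a subset: the operator returns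
`none` (i.e. `0`) whenever it would leave the subset. -/
def restrictOp {β : Type} (S : Set β) (op : β → Option β) (x : β) : Option β :=
  (op x).bind fun y => if y ∈ S then some y else none

/-! ### Polynomials: divided differences and key polynomials -/

/-- The divided difference operator `∂_i f = (f - s_i · f) / (x_i - x_{i+1})`. -/
def divDiff (i : ℕ) (fp : MvPolynomial ℕ ℤ) : MvPolynomial ℕ ℤ :=
  if h : ∃ g : MvPolynomial ℕ ℤ,
      g * (MvPolynomial.X i - MvPolynomial.X (i + 1)) =
        fp - MvPolynomial.rename (fun j => sPerm i j) fp
  then h.choose else 0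

/-- The isobaric divided difference operator `π_i f = ∂_i (x_i f)`. -/
def piOp (i : ℕ) (fp : MvPolynomial ℕ ℤ) : MvPolynomial ℕ ℤ :=
  divDiff i (MvPolynomial.X i * fp)

/-- `π_{i_1} π_{i_2} ⋯ π_{i_k} f` for a word `i_1 i_2 ⋯ i_k` (the head is applied last). -/
def piWord : List ℕ → MvPolynomial ℕ ℤ → MvPolynomial ℕ ℤ
  | [], fp => fp
  | i :: rest, fp => piOp i (piWord rest fp)

/-- `π_{b↓a} = π_{b-1} π_{b-2} ⋯ π_a` (the identity when `b ≤ a`). -/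
def piDown (b a : ℕ) (fp : MvPolynomial ℕ ℤ) : MvPolynomial ℕ ℤ :=
  piWord ((List.range' a (b - a)).reverse) fp

/-- The conjugate of a weak composition: `conjC α t = #{j ≥ 1 | α_j ≥ t}` for `t ≥ 1`. -/
def conjC (α : ℕ → ℕ) (t : ℕ) : ℕ :=
  Set.ncard {j : ℕ | 1 ≤ j ∧ 1 ≤ t ∧ t ≤ α j}

/-- The partition rearrangement of a weak composition (the conjugate of its conjugate). -/
def sortC (α : ℕ → ℕ) : ℕ → ℕ := conjC (conjC α)

/-- The length of a permutation: the common length of its reduced words. -/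
def permLength (w : Equiv.Perm ℕ) : ℕ :=
  sInf {n : ℕ | ∃ ρ : List ℕ, PosWord ρ ∧ wordPerm ρ = w ∧ ρ.length = n}

/-- The monomial `x^β = x_1^{β_1} x_2^{β_2} ⋯`. -/
def xExp (β : ℕ → ℕ) : MvPolynomial ℕ ℤ :=
  ∏ i ∈ Finset.range (sSup {n : ℕ | β n ≠ 0} + 1), MvPolynomial.X i ^ β i

/-- The key polynomial `κ_α = π_w x^λ` where `λ` is the partition rearrangement of `α` and
`w` is the minimal-length permutation of `S∞` with `α · w = λ`. -/
def keyPoly (α : ℕ → ℕ) : MvPolynomial ℕ ℤ :=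
  if h : ∃ (ρ : List ℕ) (w : Equiv.Perm ℕ), IsReducedWordFor w ρ ∧
      (∀ i, α (w i) = sortC α i) ∧
      (∀ v : Equiv.Perm ℕ, (∃ τ, IsReducedWordFor v τ) → (∀ i, α (v i) = sortC α i) →
        permLength w ≤ permLength v)
  then piWord h.choose (xExp (sortC α)) else 0

/-- The `φ`-flagged key polynomial `κ_{(α,φ)} = Σ_{T ∈ SSKT(α,φ)} x^{wt(T)}`. -/
def flaggedKeyPoly (α φ : ℕ → ℕ) : MvPolynomial ℕ ℤ :=
  ∑ᶠ T ∈ SSKT α φ, xExp (wtTab T)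

/-! ### Column insertion, keys, standardization -/

/-- The number of boxes in column `c` of a tableau. -/
def colHeightN (T : Tableau) (c : ℕ) : ℕ := Set.ncard {r : ℤ | T r c ≠ 0}

/-- One pass of column insertion: insert the value `x` starting at column `c`
(`fuel` bounds the number of columns visited). -/
def colInsertAux : ℕ → Tableau → ℕ → ℕ → Tableau
  | 0, T, _, _ => T
  | fuel + 1, T, c, x =>
    if ∀ r : ℤ, T r c ≠ 0 → T r c < x then
      -- x is greater than every entry of column c: place it at the end of the column
      fun r c' => if c' = c ∧ r = (colHeightN T c + 1 : ℤ) then x else T r c'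
    else if ∃ r : ℤ, T r c = x then
      -- column c contains x: move on to the next column with the same value
      colInsertAux fuel T (c + 1) x
    else
      -- bump the smallest entry of column c that is larger than x
      let y := sInf {v : ℕ | x < v ∧ ∃ r : ℤ, T r c = v}
      colInsertAux fuel (fun r c' => if c' = c ∧ T r c' = y then x else T r c') (c + 1) y

/-- Column insertion of `x` into the semistandard Young tableau `T`. -/
def colInsert (T : Tableau) (x : ℕ) : Tableau :=
  colInsertAux (sSup {c : ℕ | ∃ r : ℤ, T r c ≠ 0} + 2) T 1 x

/-- The insertion tableau `P` of `(v → ∅)`: successively column insert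
`v_n, v_{n-1}, …, v_1` into the empty tableau. -/
def insertP (v : List ℕ) : Tableau :=
  v.reverse.foldl colInsert (fun _ _ => 0)

/-- The recording tableau `Q` of `(v → ∅)`: the standard Young tableau whose restriction to
`{1, …, j}` has the same shape as the insertion tableau of the last `j` letters of `v`. -/
def insertQ (v : List ℕ) : Tableau := fun r c =>
  sInf {j : ℕ | insertP (v.drop (v.length - j)) r c ≠ 0}

/-- The key `key(α)`: the unique semistandard Young tableau of weight `α` such that the set
of entries of column `i+1` is a subset of the entries of column `i`; its column `c` consists
of the elements of `{x ≥ 1 | α_x ≥ c}` in increasing order from bottom to top. -/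
def keyTab (α : ℕ → ℕ) : Tableau := fun r c =>
  if c = 0 then 0
  else sInf {x : ℕ | 1 ≤ x ∧ c ≤ α x ∧
    ((Set.ncard {y : ℕ | 1 ≤ y ∧ c ≤ α y ∧ y ≤ x} : ℕ) : ℤ) = r}

/-- The standardization of a semistandard Young tableau: the `1`'s are replaced from left to
right by `1, …, β_1`, the `2`'s by `β_1 + 1, …, β_1 + β_2`, and so on. -/
def stdTab (T : Tableau) : Tableau := fun r c =>
  if T r c = 0 then 0
  else Set.ncard {p : ℤ × ℕ |
    T p.1 p.2 ≠ 0 ∧ (T p.1 p.2 < T r c ∨ (T p.1 p.2 = T r c ∧ p.2 ≤ c))}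

/-! ### Maximal factorizations (Reiner–Shimozono) -/

/-- Every block is weakly increasing. -/
def WeaklyIncrFact (g : ℕ → List ℕ) : Prop := ∀ i, List.Chain' (· ≤ ·) (g i)

/-- Maximality: the nonempty blocks have maximal length, i.e. there is a strict descent
between any two consecutive nonempty blocks (no letter can be moved from the end of a block
to the front of the next one to the right). -/
def MaxFact (g : ℕ → List ℕ) : Prop :=
  ∀ i j : ℕ, 1 ≤ i → i < j → g i ≠ [] → g j ≠ [] → (∀ m, i < m → m < j → g m = []) →
    (g i).headI < (g j).getLastD 0

/-- Reiner–Shimozono's set `𝒲(α, φ)` of `φ`-flagged maximal factorizations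
`u^• = u^n ⋯ u^2 u^1` with `ℓ(u^i) = α_i` and `(u → ∅) = (P, std(key(α)))`. -/
def Wset (α φ : ℕ → ℕ) : Set (ℕ → List ℕ) :=
  {g | g 0 = [] ∧ (∀ i, (g i).length = α i) ∧ (∀ i, ∀ x ∈ g i, 1 ≤ x) ∧
       WeaklyIncrFact g ∧ MaxFact g ∧ (∀ i, ∀ x ∈ g i, x ≤ φ i) ∧
       insertQ (factWord g) = stdTab (keyTab α)}

/-! ### Shifts and highest weight key tableaux -/

/-- `shift_N`: add `N` to every letter of every block. -/
def shiftFact (N : ℕ) (f : ℕ → List ℕ) : ℕ → List ℕ := fun i => (f i).map (· + N)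

/-- The tableau of shape `α` whose column `i` is filled by `1, 2, …, λ^T_i` in increasing
order from bottom to top (where `λ^T` is the conjugate of the partition rearrangement `λ`
of `α`): the box of column `c` in row `m` (where `α_m ≥ c`) contains the number of indices
`m' ≤ m` with `α_{m'} ≥ c`. -/
def highKeyTab (α : ℕ → ℕ) : Tableau := fun r c =>
  if c = 0 then 0
  else if ∃ m : ℕ, (m : ℤ) = r ∧ 1 ≤ m ∧ c ≤ α m then
    Set.ncard {m : ℕ | 1 ≤ m ∧ c ≤ α m ∧ (m : ℤ) ≤ r}
  else 0


/-- A `gl_n`-crystal isomorphism between two sets of key tableaux, both equipped with the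
Assaf–Schilling operators (restricted to the sets): a weight-preserving bijection commuting
with all raising and lowering operators `e_i, f_i` for `1 ≤ i < n`. -/
def SSKTIso (n : ℕ) (S₁ S₂ : Set Tableau) : Prop :=
  ∃ g : Tableau → Tableau, Set.BijOn g S₁ S₂ ∧
    (∀ T ∈ S₁, wtTab T = wtTab (g T)) ∧
    ∀ T ∈ S₁, ∀ i : ℕ, 1 ≤ i → i < n →
      Option.map g (restrictOp S₁ (keyE i) T) = restrictOp S₂ (keyE i) (g T) ∧
      Option.map g (restrictOp S₁ (keyF i) T) = restrictOp S₂ (keyF i) (g T)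

/-- `y` is the letter bumped by `x ∉ C`: the largest element of `C` below `x`. -/
def IsBumped (C : Finset ℤ) (x y : ℤ) : Prop :=
  x ∉ C ∧ y ∈ C ∧ y < x ∧ ∀ z ∈ C, z < x → z ≤ y

/-- The column state after inserting `x` into the column `C`. -/
def insS (C : Finset ℤ) (x : ℤ) : Finset ℤ := insert x (C.filter fun y => ¬ IsBumped C x y)

/-- The letter produced by inserting `x` into the column `C`, if any. -/
def insO (C : Finset ℤ) (x : ℤ) : Option ℤ :=
  if x ∈ C then some (x - 1) else if h : ∃ y, IsBumped C x y then some h.choose else none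

theorem IsBumped.unique {C : Finset ℤ} {x y z : ℤ} (hy : IsBumped C x y) (hz : IsBumped C x z) :
    y = z :=
  le_antisymm (hz.2.2.2 y hy.2.1 hy.2.2.1) (hy.2.2.2 z hz.2.1 hz.2.2.1)

theorem exists_isBumped {C : Finset ℤ} {x z : ℤ} (hx : x ∉ C) (hz : z ∈ C) (hzx : z < x) :
    ∃ y, IsBumped C x y ∧ z ≤ y := by
  obtain ⟨y, hy, hmax⟩ := (C.filter (· < x)).exists_max_image id ⟨z, by simp [hz, hzx]⟩
  simp only [Finset.mem_filter, id] at hy hmax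
  exact ⟨y, ⟨hx, hy.1, hy.2, fun w hw hwx => hmax w ⟨hw, hwx⟩⟩, hmax z ⟨hz, hzx⟩⟩

theorem mem_insS {C : Finset ℤ} {x z : ℤ} :
    z ∈ insS C x ↔ z = x ∨ z ∈ C ∧ ¬ IsBumped C x z := by
  simp [insS]

theorem mem_insO {C : Finset ℤ} {x o : ℤ} :
    insO C x = some o ↔ x ∈ C ∧ o = x - 1 ∨ IsBumped C x o := by
  unfold insO
  split_ifs with h1 h2
  · have : ¬ IsBumped C x o := fun h => h.1 h1
    simp [h1, this, eq_comm]
  · have := h2.choose_spec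
    simp only [Option.some.injEq, h1, false_and, false_or]
    exact ⟨fun h => h ▸ this, fun h => this.unique h⟩
  · simp only [not_exists] at h2
    simp [h1, h2]

theorem insO_eq_none {C : Finset ℤ} {x : ℤ} : insO C x = none ↔ ∀ z ∈ C, x < z := by
  rw [Option.eq_none_iff_forall_ne_some]
  constructor
  · intro h z hz
    by_contra hle
    by_cases hx : x ∈ C
    · exact h _ (mem_insO.2 (Or.inl ⟨hx, rfl⟩))
    · obtain ⟨y, hy, -⟩ := exists_isBumped hx hz (lt_of_le_of_ne (not_lt.1 hle) (by grind))
      exact h _ (mem_insO.2 (Or.inr hy))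
  · intro h o ho
    rcases mem_insO.1 ho with ⟨hx, -⟩ | hb
    · exact lt_irrefl _ (h x hx)
    · exact lt_asymm (h o hb.2.1) hb.2.2.1

theorem mem_insS_self (C : Finset ℤ) (x : ℤ) : x ∈ insS C x := mem_insS.2 (Or.inl rfl)

theorem insS_of_mem {C : Finset ℤ} {x : ℤ} (h : x ∈ C) : insS C x = C := by
  ext z; rw [mem_insS]; unfold IsBumped; grind

theorem insO_of_mem {C : Finset ℤ} {x : ℤ} (h : x ∈ C) : insO C x = some (x - 1) :=
  mem_insO.2 (Or.inl ⟨h, rfl⟩)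

theorem insS_of_forall_lt {C : Finset ℤ} {x : ℤ} (h : ∀ z ∈ C, x < z) :
    insS C x = insert x C := by
  ext z; rw [mem_insS, Finset.mem_insert]; unfold IsBumped; grind

theorem insO_of_forall_lt {C : Finset ℤ} {x : ℤ} (h : ∀ z ∈ C, x < z) : insO C x = none :=
  insO_eq_none.2 h

theorem insS_of_isBumped {C : Finset ℤ} {x y : ℤ} (h : IsBumped C x y) :
    insS C x = insert x (C.erase y) := by
  ext z
  rw [mem_insS, Finset.mem_insert, Finset.mem_erase]
  have : ∀ w, IsBumped C x w ↔ w = y := fun w => ⟨fun hw => hw.unique h, fun e => e ▸ h⟩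
  grind

theorem insO_of_isBumped {C : Finset ℤ} {x y : ℤ} (h : IsBumped C x y) : insO C x = some y :=
  mem_insO.2 (Or.inr h)

/-- The three cases of inserting a letter into a column. -/
theorem ins_cases (C : Finset ℤ) (x : ℤ) :
    x ∈ C ∨ (∃ y, IsBumped C x y) ∨ ∀ z ∈ C, x < z := by
  by_cases hx : x ∈ C
  · exact Or.inl hx
  · by_cases h : ∃ y, IsBumped C x y
    · exact Or.inr (Or.inl h)
    · refine Or.inr (Or.inr fun z hz => ?_)
      by_contra hle
      obtain ⟨y, hy, -⟩ := exists_isBumped hx hz (lt_of_le_of_ne (not_lt.1 hle) (by grind))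
      exact h ⟨y, hy⟩

theorem card_insS (C : Finset ℤ) (x : ℤ) :
    (insS C x).card + (insO C x).toList.length = C.card + 1 := by
  rcases ins_cases C x with h | ⟨y, h⟩ | h
  · simp [insS_of_mem h, insO_of_mem h]
  · rw [insS_of_isBumped h, insO_of_isBumped h, Finset.card_insert_of_notMem (by
      simp [h.1]), Finset.card_erase_of_mem h.2.1]
    have := Finset.card_pos.2 ⟨y, h.2.1⟩
    simp; omega
  · rw [insS_of_forall_lt h, insO_of_forall_lt h, Finset.card_insert_of_notMem (by grind)]
    simp

/-- Column states after inserting a word. -/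
def st : Finset ℤ → List ℤ → Finset ℤ
  | C, [] => C
  | C, x :: u => st (insS C x) u

/-- The letters produced by inserting a word into a column. -/
def ou : Finset ℤ → List ℤ → List ℤ
  | _, [] => []
  | C, x :: u => (insO C x).toList ++ ou (insS C x) u

theorem st_append (C : Finset ℤ) (u v : List ℤ) : st C (u ++ v) = st (st C u) v := by
  induction u generalizing C with
  | nil => rfl
  | cons x u ih => exact ih _

theorem ou_append (C : Finset ℤ) (u v : List ℤ) : ou C (u ++ v) = ou C u ++ ou (st C u) v := by
  induction u generalizing C with
  | nil => rfl
  | cons x u ih => simp [ou, st, ih]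

theorem card_st (C : Finset ℤ) (u : List ℤ) :
    (st C u).card + (ou C u).length = C.card + u.length := by
  induction u generalizing C with
  | nil => simp [st, ou]
  | cons x u ih =>
    have h1 := ih (insS C x)
    have h2 := card_insS C x
    simp only [st, ou, List.length_append, List.length_cons]
    omega

/-- A larger column stays larger. -/
theorem insS_mono {C D : Finset ℤ} (h : C ⊆ D) (x : ℤ) : insS C x ⊆ insS D x := by
  intro z hz
  rw [mem_insS] at hz ⊢
  rcases hz with hz | ⟨hz, hb⟩
  · exact Or.inl hz
  · by_cases hzx : z = x
    · exact Or.inl hzx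
    refine Or.inr ⟨h hz, fun hb' => hb ⟨fun hx => hb'.1 (h hx), hz, hb'.2.2.1, fun w hw =>
      hb'.2.2.2 w (h hw)⟩⟩

theorem st_mono {C D : Finset ℤ} (h : C ⊆ D) (u : List ℤ) : st C u ⊆ st D u := by
  induction u generalizing C D with
  | nil => exact h
  | cons x u ih => exact ih (insS_mono h x)

theorem mem_of_mem_insS {C : Finset ℤ} {x z : ℤ} (h : z ∈ insS C x) : z = x ∨ z ∈ C := by
  rw [mem_insS] at h; tauto

theorem mem_st {C : Finset ℤ} {u : List ℤ} {z : ℤ} (h : z ∈ st C u) : z ∈ C ∨ z ∈ u := by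
  induction u generalizing C with
  | nil => exact Or.inl h
  | cons x u ih =>
    rcases ih h with h | h
    · rcases mem_of_mem_insS h with rfl | h
      · simp
      · exact Or.inl h
    · simp [h]

/-- Insertions far enough apart commute. -/
theorem insO_congr_low {C D : Finset ℤ} {y : ℤ} (h : ∀ z ≤ y, z ∈ C ↔ z ∈ D) :
    insO C y = insO D y := by
  ext o
  simp only [mem_insO, IsBumped, h y le_rfl]
  refine or_congr Iff.rfl (and_congr Iff.rfl ?_)
  constructor
  · rintro ⟨h1, h2, h3⟩
    exact ⟨(h o h2.le).1 h1, h2, fun z hz hzy => h3 z ((h z hzy.le).2 hz) hzy⟩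
  · rintro ⟨h1, h2, h3⟩
    exact ⟨(h o h2.le).2 h1, h2, fun z hz hzy => h3 z ((h z hzy.le).1 hz) hzy⟩

theorem isBumped_congr_high {C D : Finset ℤ} {p x z : ℤ} (hp : p ∈ C) (hpx : p ≤ x)
    (h : ∀ z, p ≤ z → z ≤ x → (z ∈ C ↔ z ∈ D)) : IsBumped C x z ↔ IsBumped D x z := by
  unfold IsBumped
  have h1 := h x hpx le_rfl
  have h2 := h p le_rfl hpx
  have h3 := h z
  constructor
  · rintro ⟨a, b, c, d⟩
    have hlt : p < x := lt_of_le_of_ne hpx (by grind)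
    have := d p hp hlt
    refine ⟨by tauto, (h3 this c.le).1 b, c, fun w hw hwx => ?_⟩
    rcases le_or_gt p w with hpw | hpw
    · exact d w ((h w hpw hwx.le).2 hw) hwx
    · omega
  · rintro ⟨a, b, c, d⟩
    have hlt : p < x := lt_of_le_of_ne hpx (by grind)
    have := d p (h2.1 hp) hlt
    refine ⟨by tauto, (h3 this c.le).2 b, c, fun w hw hwx => ?_⟩
    rcases le_or_gt p w with hpw | hpw
    · exact d w ((h w hpw hwx.le).1 hw) hwx
    · omega

theorem insO_congr_high {C D : Finset ℤ} {p x : ℤ} (hp : p ∈ C) (hpx : p ≤ x)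
    (h : ∀ z, p ≤ z → z ≤ x → (z ∈ C ↔ z ∈ D)) : insO C x = insO D x := by
  ext o
  simp only [mem_insO, isBumped_congr_high hp hpx h, h x hpx le_rfl]

/-- Inserting `y` changes the column only at letters `≤ y`. -/
theorem mem_insS_of_lt {C : Finset ℤ} {y z : ℤ} (h : y < z) : z ∈ insS C y ↔ z ∈ C := by
  rw [mem_insS]; unfold IsBumped; grind

/-- Inserting `x` changes the column only at letters `≥ p` if `p ≤ x` lies in the column. -/
theorem mem_insS_of_lt' {C : Finset ℤ} {p x z : ℤ} (hp : p ∈ C) (hpx : p ≤ x) (h : z < p) :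
    z ∈ insS C x ↔ z ∈ C := by
  rw [mem_insS]; unfold IsBumped; grind

theorem isBumped_congr_low {C D : Finset ℤ} {y o : ℤ} (h : ∀ z ≤ y, z ∈ C ↔ z ∈ D) :
    IsBumped C y o ↔ IsBumped D y o := by
  simp only [IsBumped, h y le_rfl]
  refine and_congr Iff.rfl ?_
  constructor
  · rintro ⟨h1, h2, h3⟩
    exact ⟨(h o h2.le).1 h1, h2, fun z hz hzy => h3 z ((h z hzy.le).2 hz) hzy⟩
  · rintro ⟨h1, h2, h3⟩
    exact ⟨(h o h2.le).2 h1, h2, fun z hz hzy => h3 z ((h z hzy.le).1 hz) hzy⟩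

section Commute

variable {C : Finset ℤ} {x y p : ℤ}

theorem insO_insS_low (hy : y < p) (hp : p ∈ C) (hx : p ≤ x) :
    insO (insS C x) y = insO C y :=
  insO_congr_low fun _ hz => mem_insS_of_lt' hp hx (by omega)

theorem insO_insS_high (hy : y < p) (hp : p ∈ C) (hx : p ≤ x) :
    insO (insS C y) x = insO C x :=
  (insO_congr_high hp hx fun _ hz _ => (mem_insS_of_lt (by omega)).symm).symm

theorem insS_insS_comm (hy : y < p) (hp : p ∈ C) (hx : p ≤ x) :
    insS (insS C x) y = insS (insS C y) x := by
  ext z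
  rcases le_or_gt z y with hz | hz
  · rw [mem_insS_of_lt' ((mem_insS_of_lt hy).2 hp) hx (by omega : z < p),
      mem_insS (C := insS C x), mem_insS (C := C) (x := y),
      mem_insS_of_lt' hp hx (by omega : z < p),
      isBumped_congr_low fun w hw => mem_insS_of_lt' hp hx (by omega : w < p)]
  · rw [mem_insS_of_lt hz, mem_insS, mem_insS, mem_insS_of_lt hz,
      isBumped_congr_high hp hx fun w hw _ => (mem_insS_of_lt (by omega : y < w)).symm]

end Commute

theorem lt_of_insO {C : Finset ℤ} {x o : ℤ} (h : insO C x = some o) : o < x := by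
  rcases mem_insO.1 h with ⟨-, rfl⟩ | h
  · omega
  · exact h.2.2.1

/-- At a descent, the second letter produced is smaller than the first. -/
theorem insO_descent {C : Finset ℤ} {x y o : ℤ} (hyx : y < x)
    (ho : insO (insS C x) y = some o) : ∃ o', insO C x = some o' ∧ o < o' := by
  rcases mem_insO.1 ho with ⟨hy, rfl⟩ | hb
  · have hyC : y ∈ C := (mem_of_mem_insS hy).resolve_left hyx.ne
    by_cases hx : x ∈ C
    · exact ⟨_, insO_of_mem hx, by omega⟩
    · obtain ⟨z, hz, hyz⟩ := exists_isBumped hx hyC hyx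
      exact ⟨z, insO_of_isBumped hz, by omega⟩
  · have hox : o < x := hb.2.2.1.trans hyx
    have hoC := (mem_insS.1 hb.2.1).resolve_left hox.ne
    by_cases hx : x ∈ C
    · exact ⟨_, insO_of_mem hx, by have := hb.2.2.1; omega⟩
    · obtain ⟨z, hz, hoz⟩ := exists_isBumped hx hoC.1 hox
      exact ⟨z, insO_of_isBumped hz, lt_of_le_of_ne hoz fun e => hoC.2 (e ▸ hz)⟩

/-- At an ascent, the second letter produced is larger than the first. -/
theorem insO_ascent {C : Finset ℤ} {x y : ℤ} (hxy : x < y) :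
    ∃ o, insO (insS C x) y = some o ∧ x ≤ o := by
  by_cases hy : y ∈ insS C x
  · exact ⟨_, insO_of_mem hy, by omega⟩
  · obtain ⟨z, hz, hxz⟩ := exists_isBumped hy (mem_insS_self C x) hxy
    exact ⟨z, insO_of_isBumped hz, hxz⟩

/-- The elementary Coxeter–Knuth moves. -/
inductive CKMove : List ℤ → List ℤ → Prop
  | low (x y z : ℤ) : y < x → x < z → CKMove [x, y, z] [x, z, y]
  | high (x y z : ℤ) : y < z → z < x → CKMove [x, y, z] [y, x, z]
  | braid (i : ℤ) : CKMove [i, i + 1, i] [i + 1, i, i + 1]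

/-- The elementary Coxeter moves. -/
inductive CoxMove : List ℤ → List ℤ → Prop
  | comm (i j : ℤ) : i + 1 < j → CoxMove [i, j] [j, i]
  | braid (i : ℤ) : CoxMove [i, i + 1, i] [i + 1, i, i + 1]

/-- Words which differ by a move inside a context. -/
def InContext (R : List ℤ → List ℤ → Prop) (u v : List ℤ) : Prop :=
  ∃ a b t t', R t t' ∧ u = a ++ t ++ b ∧ v = a ++ t' ++ b

/-- The congruence of words generated by a set of moves. -/
def CtxEquiv (R : List ℤ → List ℤ → Prop) : List ℤ → List ℤ → Prop :=
  Relation.EqvGen (InContext R)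

/-- Coxeter–Knuth equivalence of integer words. -/
abbrev CK := CtxEquiv CKMove

/-- Coxeter equivalence of integer words. -/
abbrev Cox := CtxEquiv CoxMove

namespace CtxEquiv

variable {R : List ℤ → List ℤ → Prop} {u v w : List ℤ}

theorem refl (u : List ℤ) : CtxEquiv R u u := Relation.EqvGen.refl u

theorem of_eq (h : u = v) : CtxEquiv R u v := h ▸ refl u

theorem symm (h : CtxEquiv R u v) : CtxEquiv R v u := Relation.EqvGen.symm _ _ h

theorem trans (h : CtxEquiv R u v) (h' : CtxEquiv R v w) : CtxEquiv R u w :=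
  Relation.EqvGen.trans _ _ _ h h'

theorem of_move (h : R u v) : CtxEquiv R u v :=
  Relation.EqvGen.rel _ _ ⟨[], [], u, v, h, by simp, by simp⟩

/-- A map of words that respects moves in context respects the generated congruence. -/
theorem lift {S : List ℤ → List ℤ → Prop} (hS : Equivalence S)
    (hR : ∀ a b t t', R t t' → S (a ++ t ++ b) (a ++ t' ++ b)) (h : CtxEquiv R u v) : S u v := by
  induction h with
  | rel x y hxy =>
    obtain ⟨a, b, t, t', ht, rfl, rfl⟩ := hxy
    exact hR a b t t' ht
  | refl => exact hS.refl _
  | symm _ _ _ ih => exact hS.symm ih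
  | trans _ _ _ _ _ ih ih' => exact hS.trans ih ih'

theorem invariant {α : Sort*} (f : List ℤ → α)
    (hR : ∀ a b t t', R t t' → f (a ++ t ++ b) = f (a ++ t' ++ b)) (h : CtxEquiv R u v) :
    f u = f v :=
  lift (S := fun u v => f u = f v) ⟨fun _ => rfl, Eq.symm, Eq.trans⟩ hR h

theorem equivalence : Equivalence (CtxEquiv R) := ⟨refl, symm, trans⟩

theorem context (h : CtxEquiv R u v) (a b : List ℤ) : CtxEquiv R (a ++ u ++ b) (a ++ v ++ b) := by
  refine lift (S := fun u v => CtxEquiv R (a ++ u ++ b) (a ++ v ++ b))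
    ⟨fun _ => refl _, symm, trans⟩ (fun c d t t' ht => ?_) h
  exact Relation.EqvGen.rel _ _ ⟨a ++ c, d ++ b, t, t', ht, by simp, by simp⟩

theorem append_left (h : CtxEquiv R u v) (a : List ℤ) : CtxEquiv R (a ++ u) (a ++ v) := by
  simpa using h.context a []

theorem append_right (h : CtxEquiv R u v) (b : List ℤ) : CtxEquiv R (u ++ b) (v ++ b) := by
  simpa using h.context [] b

theorem cons (h : CtxEquiv R u v) (x : ℤ) : CtxEquiv R (x :: u) (x :: v) := h.append_left [x]

end CtxEquiv

theorem CK.cox {u v : List ℤ} (h : CK u v) : Cox u v := by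
  refine CtxEquiv.lift CtxEquiv.equivalence (fun a b t t' ht => CtxEquiv.context ?_ a b) h
  cases ht with
  | low x y z hyx hxz => exact (CtxEquiv.of_move (CoxMove.comm y z (by omega))).cons x
  | high x y z hyz hzx =>
    exact ((CtxEquiv.of_move (CoxMove.comm y x (by omega))).append_right [z]).symm
  | braid i => exact CtxEquiv.of_move (CoxMove.braid i)

theorem CK.length_eq {u v : List ℤ} (h : CK u v) : u.length = v.length :=
  h.invariant List.length fun a b t t' ht => by cases ht <;> simp

theorem CK.mem_iff {u v : List ℤ} (h : CK u v) (x : ℤ) : x ∈ u ↔ x ∈ v := by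
  have := h.invariant (fun w => x ∈ w) fun a b t t' ht => by
    cases ht <;> simp only [List.mem_append, List.mem_cons, List.not_mem_nil, eq_iff_iff] <;> tauto
  exact iff_of_eq this

/-- An integer word is reduced if no Coxeter-equivalent word has two equal adjacent letters. -/
def Red (u : List ℤ) : Prop := ∀ v, Cox u v → ∀ a b x, v ≠ a ++ [x, x] ++ b

theorem Red.congr {u v : List ℤ} (h : Red u) (huv : CK u v) : Red v := fun w hw =>
  h w (huv.cox.trans hw)

theorem Red.infix {a u b : List ℤ} (h : Red (a ++ u ++ b)) : Red u := by
  intro v hv c d x e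
  exact h _ (hv.context a b) (a ++ c) (d ++ b) x (by simp [e])

theorem Red.left {u v : List ℤ} (h : Red (u ++ v)) : Red u := Red.infix (a := []) (b := v) h

theorem Red.right {u v : List ℤ} (h : Red (u ++ v)) : Red v := by
  apply Red.infix (a := u) (b := []); simpa using h

/-- Reverse and negate a word. -/
def rev (u : List ℤ) : List ℤ := (u.map Neg.neg).reverse

theorem rev_append (u v : List ℤ) : rev (u ++ v) = rev v ++ rev u := by simp [rev]

theorem rev_rev (u : List ℤ) : rev (rev u) = u := by simp [rev]

theorem length_rev (u : List ℤ) : (rev u).length = u.length := by simp [rev]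

theorem mem_rev {u : List ℤ} {x : ℤ} : x ∈ rev u ↔ -x ∈ u := by
  simp only [rev, List.mem_reverse, List.mem_map]
  exact ⟨by rintro ⟨y, hy, rfl⟩; simpa using hy, fun h => ⟨_, h, by simp⟩⟩

theorem CK.rev {u v : List ℤ} (h : CK u v) : CK (rev u) (rev v) := by
  refine CtxEquiv.lift (S := fun u v => CK (_root_.rev u) (_root_.rev v))
    ⟨fun _ => .refl _, CtxEquiv.symm, CtxEquiv.trans⟩ (fun a b t t' ht => ?_) h
  simp only [rev_append, ← List.append_assoc]
  refine CtxEquiv.context ?_ _ _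
  cases ht with
  | low x y z hyx hxz =>
    exact (CtxEquiv.of_move (CKMove.high (-y) (-z) (-x) (by omega) (by omega))).symm
  | high x y z hyz hzx =>
    exact (CtxEquiv.of_move (CKMove.low (-z) (-x) (-y) (by omega) (by omega))).symm
  | braid i =>
    have := (CtxEquiv.of_move (CKMove.braid (-(i + 1)))).symm
    rw [show -(i + 1) + 1 = -i by ring] at this
    exact this

theorem Cox.rev {u v : List ℤ} (h : Cox u v) : Cox (rev u) (rev v) := by
  refine CtxEquiv.lift (S := fun u v => Cox (_root_.rev u) (_root_.rev v))
    ⟨fun _ => .refl _, CtxEquiv.symm, CtxEquiv.trans⟩ (fun a b t t' ht => ?_) h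
  simp only [rev_append, ← List.append_assoc]
  refine CtxEquiv.context ?_ _ _
  cases ht with
  | comm i j hij => exact CtxEquiv.of_move (CoxMove.comm (-j) (-i) (by omega))
  | braid i =>
    have := (CtxEquiv.of_move (CoxMove.braid (-(i + 1)))).symm
    rw [show -(i + 1) + 1 = -i by ring] at this
    exact this

theorem Red.rev {u : List ℤ} (h : Red u) : Red (rev u) := by
  intro v hv a b x e
  have h1 := hv.rev
  rw [rev_rev] at h1
  refine h _ h1 (_root_.rev b) (_root_.rev a) (-x) ?_
  rw [e, rev_append, rev_append, List.append_assoc]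
  rfl

/-- The decreasing word of a finite set. -/
def cw (C : Finset ℤ) : List ℤ := C.sort (· ≥ ·)

theorem mem_cw {C : Finset ℤ} {x : ℤ} : x ∈ cw C ↔ x ∈ C := Finset.mem_sort _

theorem length_cw (C : Finset ℤ) : (cw C).length = C.card := Finset.length_sort _

theorem pairwise_cw (C : Finset ℤ) : (cw C).Pairwise (· > ·) :=
  (Finset.sortedGT_sort C).pairwise

theorem cw_eq {C : Finset ℤ} {l : List ℤ} (hl : l.Pairwise (· > ·)) (h : ∀ x, x ∈ l ↔ x ∈ C) :
    cw C = l :=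
  (pairwise_cw C).eq_of_mem_iff hl fun x => by rw [mem_cw, h]

theorem cw_empty : cw ∅ = [] := cw_eq List.Pairwise.nil (by simp)

theorem ck_move_left {y x : ℤ} {B : List ℤ} (hB : (y :: B).Pairwise (· > ·)) (hyx : y < x) :
    CK (y :: B ++ [x]) (y :: x :: B) := by
  induction B generalizing y with
  | nil => exact .refl _
  | cons b B ih =>
    have hb : b < y := by simp at hB; exact hB.1.1
    refine ((ih hB.of_cons (hb.trans hyx)).cons y).trans ?_
    exact (CtxEquiv.of_move (CKMove.low y b x hb hyx)).append_right B

theorem ck_move_front {y x : ℤ} {A : List ℤ} (hA : (A ++ [x]).Pairwise (· > ·)) (hyx : y < x) :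
    CK (A ++ [y, x]) (y :: A ++ [x]) := by
  induction A with
  | nil => exact .refl _
  | cons a A ih =>
    refine ((ih hA.of_cons).cons a).trans ?_
    obtain ⟨h, t, ht⟩ : ∃ h t, A ++ [x] = h :: t := by cases A <;> simp
    have ha : h < a := by
      have := List.rel_of_pairwise_cons hA (a' := h) (by
        rw [show A.append [x] = A ++ [x] from rfl, ht]; simp)
      exact this
    have hh : y < h := by
      cases A with
      | nil => simp at ht; omega
      | cons b A =>
        simp at ht
        have := List.rel_of_pairwise_cons hA.of_cons (a' := x) (by simp)
        omega
    have := (CtxEquiv.of_move (CKMove.high a y h hh ha)).append_right t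
    simpa [ht] using this

theorem cox_move_left {x : ℤ} {B : List ℤ} (hB : ∀ b ∈ B, b + 1 < x) :
    Cox (B ++ [x]) (x :: B) := by
  induction B with
  | nil => exact .refl _
  | cons b B ih =>
    refine ((ih fun b hb => hB b (by simp [hb])).cons b).trans ?_
    exact (CtxEquiv.of_move (CoxMove.comm b x (hB b (by simp)))).append_right B

theorem sub_one_mem_of_red {C : Finset ℤ} {x : ℤ} (h : Red (cw C ++ [x])) (hx : x ∈ C) :
    x - 1 ∈ C := by
  by_contra hx1
  obtain ⟨A, B, hAB⟩ := List.append_of_mem (mem_cw.2 hx)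
  have hp := pairwise_cw C
  rw [hAB] at h hp
  have hB : ∀ b ∈ B, b + 1 < x := by
    intro b hb
    have h1 : b < x := List.rel_of_pairwise_cons (List.pairwise_append.1 hp).2.1 hb
    have h2 : b ∈ C := mem_cw.1 (by rw [hAB]; simp [hb])
    have : b ≠ x - 1 := fun e => hx1 (e ▸ h2)
    omega
  have := ((cox_move_left hB).cons x).append_left A
  refine h _ ?_ A B x rfl
  simpa using this

/-- Inserting a letter into a column word. -/
theorem ck_cw_append {C : Finset ℤ} {x : ℤ} (hx : x ∈ C → x - 1 ∈ C) :
    CK (cw C ++ [x]) ((insO C x).toList ++ cw (insS C x)) := by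
  have hp := pairwise_cw C
  rcases ins_cases C x with h | ⟨y, h⟩ | h
  · obtain ⟨A, B, hAB⟩ := List.append_of_mem (mem_cw.2 h)
    rw [insS_of_mem h, insO_of_mem h]
    rw [hAB] at hp ⊢
    have hpA := List.pairwise_append.1 hp
    have h1 : x - 1 ∈ A ++ x :: B := hAB ▸ mem_cw.2 (hx h)
    cases B with
    | nil =>
      simp only [List.mem_append, List.mem_singleton] at h1
      rcases h1 with h1 | h1
      · have := hpA.2.2 _ h1 x (by simp); omega
      · omega
    | cons b B =>
      have hbx : b < x := List.rel_of_pairwise_cons hpA.2.1 (by simp)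
      obtain rfl : b = x - 1 := by
        simp only [List.mem_append, List.mem_cons] at h1
        rcases h1 with h1 | h1 | h1 | h1
        · have := hpA.2.2 _ h1 x (by simp); omega
        · omega
        · exact h1.symm
        · have := List.rel_of_pairwise_cons hpA.2.1.of_cons h1; omega
      have e1 := ((ck_move_left hpA.2.1.of_cons hbx).cons x).append_left A
      have e2 := (CtxEquiv.of_move (CKMove.braid (x - 1))).symm.context A B
      rw [sub_add_cancel] at e2
      have hA : (A ++ [x]).Pairwise (· > ·) := by
        refine List.Pairwise.sublist ?_ hp
        simp
      have e3 := (ck_move_front hA hbx).append_right ((x - 1) :: B)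
      simpa using e1.trans (CtxEquiv.trans (CtxEquiv.of_eq (by simp)) (e2.trans
        (CtxEquiv.trans (CtxEquiv.of_eq (by simp)) e3)))
  · obtain ⟨A, B, hAB⟩ := List.append_of_mem (mem_cw.2 h.2.1)
    have hmem : ∀ z, z ∈ C ↔ z ∈ A ∨ z = y ∨ z ∈ B := fun z => by
      rw [← mem_cw, hAB]; simp
    rw [hAB] at hp
    have hpA := List.pairwise_append.1 hp
    have hAx : ∀ a ∈ A, x < a := by
      intro a ha
      have h1 := hpA.2.2 a ha y (by simp)
      have h2 := h.2.2.2 a ((hmem a).2 (Or.inl ha))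
      have h3 : a ≠ x := fun e => h.1 (e ▸ (hmem a).2 (Or.inl ha))
      omega
    have hyB : ∀ b ∈ B, b < y := fun b hb => List.rel_of_pairwise_cons hpA.2.1 hb
    have hyx := h.2.2.1
    have hp' : (A ++ x :: B).Pairwise (· > ·) := by
      rw [List.pairwise_append, List.pairwise_cons]
      refine ⟨hpA.1, ⟨fun b hb => (hyB b hb).trans hyx, hpA.2.1.of_cons⟩, fun a ha b hb => ?_⟩
      rcases List.mem_cons.1 hb with rfl | hb
      · exact hAx a ha
      · exact hpA.2.2 a ha b (by simp [hb])
    have e : cw (insS C x) = A ++ x :: B := by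
      refine cw_eq hp' fun z => ?_
      rw [insS_of_isBumped h, Finset.mem_insert, Finset.mem_erase, hmem]
      have h4 : y ∉ A := fun hy => lt_irrefl _ (hpA.2.2 y hy y (by simp))
      have h5 : y ∉ B := fun hy => lt_irrefl _ (hyB y hy)
      simp only [List.mem_append, List.mem_cons]
      constructor
      · rintro (hz | hz | hz)
        · exact Or.inr ⟨fun e => h4 (e ▸ hz), Or.inl hz⟩
        · exact Or.inl hz
        · exact Or.inr ⟨fun e => h5 (e ▸ hz), Or.inr (Or.inr hz)⟩
      · tauto
    rw [e, hAB, insO_of_isBumped h]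
    have e1 := (ck_move_left hpA.2.1 hyx).append_left A
    have hA : (A ++ [x]).Pairwise (· > ·) := hp'.sublist (by simp)
    have e2 := (ck_move_front hA hyx).append_right B
    simpa using e1.trans (CtxEquiv.trans (CtxEquiv.of_eq (by simp)) e2)
  · have e : cw (insS C x) = cw C ++ [x] := by
      refine cw_eq ?_ fun z => ?_
      · rw [List.pairwise_append]
        refine ⟨hp, by simp, fun a ha b hb => ?_⟩
        rw [List.mem_singleton.1 hb]
        exact h a (mem_cw.1 ha)
      · rw [insS_of_forall_lt h]
        simp [mem_cw, or_comm]
    rw [e, insO_of_forall_lt h]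
    exact .refl _

/-- Inserting the word never meets a letter `x` of the column without `x - 1`. -/
def Ok : Finset ℤ → List ℤ → Prop
  | _, [] => True
  | C, x :: u => (x ∈ C → x - 1 ∈ C) ∧ Ok (insS C x) u

theorem ok_append {C : Finset ℤ} {u v : List ℤ} : Ok C (u ++ v) ↔ Ok C u ∧ Ok (st C u) v := by
  induction u generalizing C with
  | nil => simp [Ok, st]
  | cons x u ih => simp [Ok, st, ih, and_assoc]

theorem Red.ok {C : Finset ℤ} {u : List ℤ} (h : Red (cw C ++ u)) : Ok C u := by
  induction u generalizing C with
  | nil => trivial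
  | cons x u ih =>
    rw [← List.singleton_append, ← List.append_assoc] at h
    have hx : x ∈ C → x - 1 ∈ C := sub_one_mem_of_red h.left
    refine ⟨hx, ih ?_⟩
    have := h.congr ((ck_cw_append hx).append_right u)
    rw [List.append_assoc] at this
    exact this.right

theorem ck_cw_append_word {C : Finset ℤ} {u : List ℤ} (h : Ok C u) :
    CK (cw C ++ u) (ou C u ++ cw (st C u)) := by
  induction u generalizing C with
  | nil => simpa [ou, st] using CtxEquiv.refl _
  | cons x u ih =>
    have h1 := (ck_cw_append h.1).append_right u
    have h2 := (ih h.2).append_left (insO C x).toList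
    simp only [ou, st, List.append_assoc] at h1 h2 ⊢
    exact CtxEquiv.trans (CtxEquiv.of_eq (by simp)) (h1.trans h2)

theorem Red.ok_empty {u : List ℤ} (h : Red u) : Ok ∅ u := Red.ok (by simpa [cw_empty])

theorem ck_out {u : List ℤ} (h : Red u) : CK u (ou ∅ u ++ cw (st ∅ u)) := by
  simpa [cw_empty] using ck_cw_append_word h.ok_empty

theorem insO_ne_none {C : Finset ℤ} {p x : ℤ} (hp : p ∈ C) (hpx : p ≤ x) :
    ∃ a, insO C x = some a := by
  rw [← Option.ne_none_iff_exists', Ne, insO_eq_none]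
  exact fun h => absurd (h p hp) (by omega)

/-- `[x, y, z] ~ [y, x, z]` when the first two letters do not interact. -/
theorem ck_ou_high_of_mem {C : Finset ℤ} {x y z p : ℤ} (hyz : y < z) (hzx : z < x) (hp : p ∈ C)
    (hyp : y < p) (hpx : p ≤ x) :
    st C [x, y, z] = st C [y, x, z] ∧ CK (ou C [x, y, z]) (ou C [y, x, z]) := by
  have hc := insS_insS_comm hyp hp hpx
  have h1 := insO_insS_low hyp hp hpx
  have h2 := insO_insS_high hyp hp hpx
  obtain ⟨a, ha⟩ := insO_ne_none hp hpx
  obtain ⟨c, hc', hyc⟩ := insO_ascent (C := insS C x) hyz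
  refine ⟨by simp [st, hc], ?_⟩
  have hca : c < a := by
    rw [hc] at hc'
    obtain ⟨a', ha', h⟩ := insO_descent hzx hc'
    rw [h2, ha, Option.some_inj] at ha'
    omega
  simp only [ou, ← hc, h1, h2, ha, hc']
  cases hb : insO C y with
  | none => exact .refl _
  | some b => exact CtxEquiv.of_move (CKMove.high a b c (by have := lt_of_insO hb; omega) hca)

theorem ins_eq_of_isBumped {C : Finset ℤ} {x y : ℤ} (h : IsBumped C x y) :
    insO C x = some y ∧ insS C x = insert x (C.erase y) :=
  ⟨insO_of_isBumped h, insS_of_isBumped h⟩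

theorem ins_eq_of_forall_lt {C : Finset ℤ} {x : ℤ} (h : ∀ z ∈ C, x < z) :
    insO C x = none ∧ insS C x = insert x C :=
  ⟨insO_of_forall_lt h, insS_of_forall_lt h⟩

theorem ins_eq_of_mem {C : Finset ℤ} {x : ℤ} (h : x ∈ C) :
    insO C x = some (x - 1) ∧ insS C x = C :=
  ⟨insO_of_mem h, insS_of_mem h⟩

theorem ck_ou_high_of_gap {C : Finset ℤ} {x y z : ℤ} (hyz : y < z) (hzx : z < x)
    (hgap : ∀ p ∈ C, y < p → x < p) (hy : y ∉ C) :
    st C [x, y, z] = st C [y, x, z] ∧ CK (ou C [x, y, z]) (ou C [y, x, z]) := by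
  rcases ins_cases C y with h | ⟨p, hp⟩ | h
  · exact absurd h hy
  · obtain ⟨o1, s1⟩ := ins_eq_of_isBumped (C := C) (x := x) (y := p) (by
      unfold IsBumped at hp ⊢; grind)
    obtain ⟨o2, s2⟩ := ins_eq_of_isBumped hp
    obtain ⟨o3, s3⟩ := ins_eq_of_isBumped (C := insert y (C.erase p)) (x := x) (y := y) (by
      unfold IsBumped at hp ⊢; grind)
    rcases ins_cases (C.erase p) y with h | ⟨q, hq⟩ | h
    · simp [hy] at h
    · obtain ⟨o4, s4⟩ := ins_eq_of_isBumped (C := insert x (C.erase p)) (x := y) (y := q) (by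
        unfold IsBumped at hp hq ⊢; grind)
      obtain ⟨o5, s5⟩ := ins_eq_of_isBumped
        (C := insert y ((insert x (C.erase p)).erase q)) (x := z) (y := y) (by
        unfold IsBumped at hp hq ⊢; grind)
      obtain ⟨o6, s6⟩ := ins_eq_of_isBumped
        (C := insert x ((insert y (C.erase p)).erase y)) (x := z) (y := q) (by
        unfold IsBumped at hp hq ⊢; grind)
      simp only [st, ou, s1, s2, s3, s4, s5, s6, o1, o2, o3, o4, o5, o6]
      refine ⟨by unfold IsBumped at hp hq; ext w; grind, ?_⟩
      exact CtxEquiv.of_move (CKMove.low p q y (by unfold IsBumped at hp hq; grind) hp.2.2.1)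
    · obtain ⟨o4, s4⟩ := ins_eq_of_forall_lt (C := insert x (C.erase p)) (x := y) (by
        unfold IsBumped at hp; grind)
      obtain ⟨o5, s5⟩ := ins_eq_of_isBumped
        (C := insert y (insert x (C.erase p))) (x := z) (y := y) (by
        unfold IsBumped at hp ⊢; grind)
      obtain ⟨o6, s6⟩ := ins_eq_of_forall_lt
        (C := insert x ((insert y (C.erase p)).erase y)) (x := z) (by
        unfold IsBumped at hp; grind)
      simp only [st, ou, s1, s2, s3, s4, s5, s6, o1, o2, o3, o4, o5, o6]
      exact ⟨by unfold IsBumped at hp; ext w; grind, .refl _⟩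
  · obtain ⟨o1, s1⟩ := ins_eq_of_forall_lt (C := C) (x := x) (by grind)
    obtain ⟨o2, s2⟩ := ins_eq_of_forall_lt h
    obtain ⟨o3, s3⟩ := ins_eq_of_isBumped (C := insert y C) (x := x) (y := y) (by
      unfold IsBumped; grind)
    obtain ⟨o4, s4⟩ := ins_eq_of_forall_lt (C := insert x C) (x := y) (by grind)
    obtain ⟨o5, s5⟩ := ins_eq_of_isBumped (C := insert y (insert x C)) (x := z) (y := y) (by
      unfold IsBumped; grind)
    obtain ⟨o6, s6⟩ := ins_eq_of_forall_lt (C := insert x ((insert y C).erase y)) (x := z) (by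
      grind)
    simp only [st, ou, s1, s2, s3, s4, s5, s6, o1, o2, o3, o4, o5, o6]
    exact ⟨by ext w; grind, .refl _⟩

theorem ck_ou_high_of_gap_mem {C : Finset ℤ} {x y z : ℤ} (hyz : y < z) (hzx : z < x)
    (hgap : ∀ p ∈ C, y < p → x < p) (hy : y ∈ C) (hy1 : y - 1 ∈ C) :
    st C [x, y, z] = st C [y, x, z] ∧ CK (ou C [x, y, z]) (ou C [y, x, z]) := by
  obtain ⟨o1, s1⟩ := ins_eq_of_isBumped (C := C) (x := x) (y := y) (by unfold IsBumped; grind)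
  obtain ⟨o2, s2⟩ := ins_eq_of_mem hy
  obtain ⟨o4, s4⟩ := ins_eq_of_isBumped (C := insert x (C.erase y)) (x := y) (y := y - 1) (by
    unfold IsBumped; grind)
  obtain ⟨o5, s5⟩ := ins_eq_of_isBumped
    (C := insert y ((insert x (C.erase y)).erase (y - 1))) (x := z) (y := y) (by
    unfold IsBumped; grind)
  obtain ⟨o6, s6⟩ := ins_eq_of_isBumped
    (C := insert x (C.erase y)) (x := z) (y := y - 1) (by
    unfold IsBumped; grind)
  simp only [st, ou, s1, s2, s4, s5, s6, o1, o2, o4, o5, o6]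
  refine ⟨by ext w; grind, ?_⟩
  have := CtxEquiv.of_move (CKMove.braid (y - 1))
  rw [sub_add_cancel] at this
  exact this.symm

theorem ck_ou_braid {C : Finset ℤ} {a : ℤ} (hok : a ∈ C → a - 1 ∈ C)
    (hok' : a + 1 ∈ C → a ∈ C) :
    st C [a, a + 1, a] = st C [a + 1, a, a + 1] ∧
      CK (ou C [a, a + 1, a]) (ou C [a + 1, a, a + 1]) := by
  have hbr := CtxEquiv.of_move (CKMove.braid (a - 1))
  rw [sub_add_cancel] at hbr
  by_cases hb : a + 1 ∈ C
  · have ha := hok' hb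
    obtain ⟨o1, s1⟩ := ins_eq_of_mem hb
    obtain ⟨o2, s2⟩ := ins_eq_of_mem ha
    simp only [st, ou, s1, s2, o1, o2, add_sub_cancel_right]
    exact ⟨trivial, hbr⟩
  by_cases ha : a ∈ C
  · have ha1 := hok ha
    obtain ⟨o1, s1⟩ := ins_eq_of_mem ha
    obtain ⟨o2, s2⟩ := ins_eq_of_isBumped (C := C) (x := a + 1) (y := a) (by
      unfold IsBumped; grind)
    obtain ⟨o3, s3⟩ := ins_eq_of_isBumped (C := insert (a + 1) (C.erase a)) (x := a)
      (y := a - 1) (by unfold IsBumped; grind)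
    obtain ⟨o4, s4⟩ := ins_eq_of_mem
      (C := insert a ((insert (a + 1) (C.erase a)).erase (a - 1))) (x := a + 1) (by grind)
    simp only [st, ou, s1, s2, s3, s4, o1, o2, o3, o4, add_sub_cancel_right]
    exact ⟨trivial, hbr⟩
  · rcases ins_cases C a with h | ⟨p, hp⟩ | h
    · exact absurd h ha
    · obtain ⟨o1, s1⟩ := ins_eq_of_isBumped hp
      obtain ⟨o2, s2⟩ := ins_eq_of_isBumped (C := insert a (C.erase p)) (x := a + 1) (y := a) (by
        unfold IsBumped at hp ⊢; grind)
      obtain ⟨o3, s3⟩ := ins_eq_of_isBumped (C := C) (x := a + 1) (y := p) (by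
        unfold IsBumped at hp ⊢; grind)
      rcases ins_cases (C.erase p) a with h | ⟨q, hq⟩ | h
      · simp [ha] at h
      · obtain ⟨o4, s4⟩ := ins_eq_of_isBumped
          (C := insert (a + 1) ((insert a (C.erase p)).erase a)) (x := a) (y := q) (by
          unfold IsBumped at hp hq ⊢; grind)
        obtain ⟨o5, s5⟩ := ins_eq_of_isBumped
          (C := insert (a + 1) (C.erase p)) (x := a) (y := q) (by
          unfold IsBumped at hp hq ⊢; grind)
        obtain ⟨o6, s6⟩ := ins_eq_of_mem
          (C := insert a ((insert (a + 1) (C.erase p)).erase q)) (x := a + 1) (by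
          unfold IsBumped at hp hq; grind)
        simp only [st, ou, s1, s2, s3, s4, s5, s6, o1, o2, o3, o4, o5, o6, add_sub_cancel_right]
        refine ⟨by unfold IsBumped at hp hq; ext w; grind, ?_⟩
        exact (CtxEquiv.of_move
          (CKMove.low p q a (by unfold IsBumped at hp hq; grind) hp.2.2.1)).symm
      · obtain ⟨o4, s4⟩ := ins_eq_of_forall_lt
          (C := insert (a + 1) ((insert a (C.erase p)).erase a)) (x := a) (by
          unfold IsBumped at hp; grind)
        obtain ⟨o5, s5⟩ := ins_eq_of_forall_lt
          (C := insert (a + 1) (C.erase p)) (x := a) (by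
          unfold IsBumped at hp; grind)
        obtain ⟨o6, s6⟩ := ins_eq_of_mem
          (C := insert a (insert (a + 1) (C.erase p))) (x := a + 1) (by grind)
        simp only [st, ou, s1, s2, s3, s4, s5, s6, o1, o2, o3, o4, o5, o6, add_sub_cancel_right]
        exact ⟨by unfold IsBumped at hp; ext w; grind, .refl _⟩
    · obtain ⟨o1, s1⟩ := ins_eq_of_forall_lt h
      obtain ⟨o2, s2⟩ := ins_eq_of_isBumped (C := insert a C) (x := a + 1) (y := a) (by
        unfold IsBumped; grind)
      obtain ⟨o3, s3⟩ := ins_eq_of_forall_lt (C := C) (x := a + 1) (by grind)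
      obtain ⟨o4, s4⟩ := ins_eq_of_forall_lt
        (C := insert (a + 1) ((insert a C).erase a)) (x := a) (by grind)
      obtain ⟨o5, s5⟩ := ins_eq_of_forall_lt (C := insert (a + 1) C) (x := a) (by grind)
      obtain ⟨o6, s6⟩ := ins_eq_of_mem
        (C := insert a (insert (a + 1) C)) (x := a + 1) (by grind)
      simp only [st, ou, s1, s2, s3, s4, s5, s6, o1, o2, o3, o4, o5, o6, add_sub_cancel_right]
      exact ⟨by ext w; grind, .refl _⟩

/-- Coxeter–Knuth moves do not change the column state, and change the produced word by
Coxeter–Knuth moves. -/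
theorem ck_ou_move {C : Finset ℤ} {t t' : List ℤ} (h : CKMove t t') (hok : Ok C t)
    (hok' : Ok C t') : st C t = st C t' ∧ CK (ou C t) (ou C t') := by
  cases h with
  | low x y z hyx hxz =>
    have hx := mem_insS_self C x
    have hc := insS_insS_comm hyx hx hxz.le
    have h1 := insO_insS_low hyx hx hxz.le
    have h2 := insO_insS_high hyx hx hxz.le
    obtain ⟨c, hc', hxc⟩ := insO_ascent (C := C) hxz
    refine ⟨by simp [st, hc], ?_⟩
    simp only [ou, h1, h2, hc']
    cases hb : insO (insS C x) y with
    | none => exact .refl _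
    | some b =>
      obtain ⟨a, ha, hba⟩ := insO_descent hyx hb
      rw [ha]
      exact CtxEquiv.of_move (CKMove.low a b c hba ((lt_of_insO ha).trans_le hxc))
  | high x y z hyz hzx =>
    by_cases hp : ∃ p ∈ C, y < p ∧ p ≤ x
    · obtain ⟨p, hp, hyp, hpx⟩ := hp
      exact ck_ou_high_of_mem hyz hzx hp hyp hpx
    · have hgap : ∀ p ∈ C, y < p → x < p := fun p h1 h2 => by
        by_contra h3
        exact hp ⟨p, h1, h2, by omega⟩
      by_cases hy : y ∈ C
      · exact ck_ou_high_of_gap_mem hyz hzx hgap hy (hok'.1 hy)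
      · exact ck_ou_high_of_gap hyz hzx hgap hy
  | braid a =>
    exact ck_ou_braid hok.1 fun h => by simpa using hok'.1 h

/-- The column state is a Coxeter–Knuth invariant, and so is the class of the produced word. -/
theorem ck_invariant {u v : List ℤ} (h : CK u v) (hu : Red u) :
    st ∅ u = st ∅ v ∧ CK (ou ∅ u) (ou ∅ v) := by
  induction h with
  | rel u v h =>
    have hv : Red v := hu.congr (Relation.EqvGen.rel _ _ h)
    obtain ⟨a, b, t, t', ht, rfl, rfl⟩ := h
    have h1 := hu.ok_empty
    have h2 := hv.ok_empty
    rw [ok_append, ok_append] at h1 h2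
    obtain ⟨e1, e2⟩ := ck_ou_move ht h1.1.2 h2.1.2
    simp only [st_append, ou_append, e1]
    exact ⟨trivial, e2.context _ _⟩
  | refl u => exact ⟨rfl, .refl _⟩
  | symm u v h ih =>
    have := ih (hu.congr (CtxEquiv.symm h))
    exact ⟨this.1.symm, this.2.symm⟩
  | trans u v w huv hvw ih1 ih2 =>
    obtain ⟨a, b⟩ := ih1 hu
    obtain ⟨c, d⟩ := ih2 (hu.congr huv)
    exact ⟨a.trans c, CtxEquiv.trans b d⟩

theorem card_le_card_insS (C : Finset ℤ) (x : ℤ) : C.card ≤ (insS C x).card := by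
  have := card_insS C x
  cases h : insO C x <;> simp [h] at this <;> omega

theorem card_le_card_st (C : Finset ℤ) (u : List ℤ) : C.card ≤ (st C u).card := by
  induction u generalizing C with
  | nil => exact le_rfl
  | cons x u ih => exact (card_le_card_insS C x).trans (ih _)

/-- A decreasing word below the column is added to the column. -/
theorem st_decreasing {C : Finset ℤ} {l : List ℤ} (hl : l.Pairwise (· > ·))
    (h : ∀ x ∈ l, ∀ c ∈ C, x < c) : ou C l = [] ∧ ∀ z, z ∈ st C l ↔ z ∈ C ∨ z ∈ l := by
  induction l generalizing C with
  | nil => simp [ou, st]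
  | cons x l ih =>
    have hx : ∀ c ∈ C, x < c := h x (by simp)
    obtain ⟨h1, h2⟩ := ih (C := insS C x) hl.of_cons fun y hy c hc => by
      rcases mem_of_mem_insS hc with rfl | hc
      · exact List.rel_of_pairwise_cons hl hy
      · exact h y (by simp [hy]) c hc
    refine ⟨by simp [ou, h1, insO_of_forall_lt hx], fun z => ?_⟩
    rw [st, h2, insS_of_forall_lt hx]
    simp only [Finset.mem_insert, List.mem_cons]
    tauto

theorem card_st_decreasing {l : List ℤ} (hl : l.Pairwise (· > ·)) :
    (st ∅ l).card = l.length := by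
  have h := card_st ∅ l
  rw [(st_decreasing (C := ∅) hl (by simp)).1] at h
  simpa using h

theorem rev_pairwise {l : List ℤ} (hl : l.Pairwise (· > ·)) : (rev l).Pairwise (· > ·) := by
  rw [rev, List.pairwise_reverse, List.pairwise_map]
  exact hl.imp fun h => by simpa using h

theorem Red.out {u : List ℤ} (h : Red u) : Red (ou ∅ u) := (h.congr (ck_out h)).left

theorem card_st_le_rev {u : List ℤ} (h : Red u) : (st ∅ u).card ≤ (st ∅ (rev u)).card := by
  have h1 := (ck_out h).rev
  rw [(ck_invariant h1 h.rev).1, rev_append, st_append]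
  refine le_trans ?_ (card_le_card_st _ _)
  rw [card_st_decreasing (rev_pairwise (pairwise_cw _)), length_rev, length_cw]

theorem card_st_rev {u : List ℤ} (h : Red u) : (st ∅ (rev u)).card = (st ∅ u).card := by
  refine le_antisymm ?_ (card_st_le_rev h)
  simpa [rev_rev] using card_st_le_rev h.rev

/-- A decreasing suffix bounds the height of the column from below. -/
theorem length_le_card_st {u l : List ℤ} (h : Red (u ++ l)) (hl : l.Pairwise (· > ·)) :
    l.length ≤ (st ∅ (u ++ l)).card := by
  rw [← card_st_rev h, rev_append, st_append]
  refine le_trans ?_ (card_le_card_st _ _)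
  rw [card_st_decreasing (rev_pairwise hl), length_rev]

/-- The first column of the left key. -/
def lkey (u : List ℤ) : Finset ℤ := (st ∅ (rev u)).image Neg.neg

/-- The `i`-th column of the left key, counted from `0`. -/
def keyCol : ℕ → List ℤ → Finset ℤ
  | 0, u => lkey u
  | i + 1, u => keyCol i (ou ∅ u)

theorem mem_lkey {u : List ℤ} {x : ℤ} : x ∈ lkey u ↔ -x ∈ st ∅ (rev u) := by
  simp only [lkey, Finset.mem_image]
  exact ⟨by rintro ⟨y, hy, rfl⟩; simpa using hy, fun h => ⟨_, h, by simp⟩⟩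

theorem card_lkey {u : List ℤ} (h : Red u) : (lkey u).card = (st ∅ u).card := by
  rw [lkey, Finset.card_image_of_injective _ neg_injective, card_st_rev h]

theorem lkey_congr {u v : List ℤ} (h : CK u v) (hu : Red u) : lkey u = lkey v := by
  rw [lkey, lkey, (ck_invariant h.rev hu.rev).1]

theorem keyCol_congr {i : ℕ} {u v : List ℤ} (h : CK u v) (hu : Red u) :
    keyCol i u = keyCol i v := by
  induction i generalizing u v with
  | zero => exact lkey_congr h hu
  | succ i ih => exact ih (ck_invariant h hu).2 hu.out

theorem lkey_subset_append (u v : List ℤ) : lkey u ⊆ lkey (u ++ v) := by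
  intro x hx
  rw [mem_lkey] at hx ⊢
  rw [rev_append, st_append]
  exact st_mono (Finset.empty_subset _) _ hx

theorem mem_of_mem_lkey {u : List ℤ} {x : ℤ} (h : x ∈ lkey u) : x ∈ u := by
  rw [mem_lkey] at h
  simpa [mem_rev] using mem_st h

theorem keyCol_succ_subset {i : ℕ} {u : List ℤ} (h : Red u) : keyCol (i + 1) u ⊆ keyCol i u := by
  induction i generalizing u with
  | zero =>
    show lkey (ou ∅ u) ⊆ lkey u
    rw [lkey_congr (ck_out h) h]
    exact lkey_subset_append _ _
  | succ i ih => exact ih h.out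

theorem keyCol_anti {i j : ℕ} (hij : i ≤ j) {u : List ℤ} (h : Red u) :
    keyCol j u ⊆ keyCol i u := by
  induction hij with
  | refl => exact subset_rfl
  | step _ ih => exact (keyCol_succ_subset h).trans ih

theorem mem_of_mem_keyCol {i : ℕ} {u : List ℤ} (h : Red u) {x : ℤ} (hx : x ∈ keyCol i u) :
    x ∈ u :=
  mem_of_mem_lkey (keyCol_anti (Nat.zero_le i) h hx)

theorem card_st_pos {u : List ℤ} (h : u ≠ []) : 0 < (st ∅ u).card := by
  cases u with
  | nil => exact absurd rfl h
  | cons x u =>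
    exact lt_of_lt_of_le (Finset.card_pos.2 ⟨x, mem_insS_self _ _⟩) (card_le_card_st _ _)

theorem length_out_lt {u : List ℤ} (h : u ≠ []) : (ou ∅ u).length < u.length := by
  have h1 := card_st ∅ u
  have h2 := card_st_pos h
  simp at h1
  omega

theorem keyCol_nil (i : ℕ) : keyCol i [] = ∅ := by
  induction i with
  | zero => rfl
  | succ i ih => exact ih

theorem sum_card_keyCol {n : ℕ} {u : List ℤ} (h : Red u) (hn : u.length ≤ n) :
    ∑ i ∈ Finset.range n, (keyCol i u).card = u.length := by
  induction n generalizing u with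
  | zero => simp_all
  | succ n ih =>
    by_cases hu : u = []
    · simp [hu, keyCol_nil]
    · have h1 := length_out_lt hu
      have h2 := card_st ∅ u
      rw [Finset.sum_range_succ', show ∑ i ∈ Finset.range n, (keyCol (i + 1) u).card =
        (ou ∅ u).length from ih h.out (by omega), show keyCol 0 u = lkey u from rfl, card_lkey h]
      simp at h2
      omega

theorem keyCol_eq_empty {i : ℕ} {u : List ℤ} (hi : u.length ≤ i) : keyCol i u = ∅ := by
  induction i generalizing u with
  | zero =>
    rw [List.eq_nil_of_length_eq_zero (Nat.le_zero.1 hi)]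
    rfl
  | succ i ih =>
    by_cases hu : u = []
    · simp [hu, keyCol_nil]
    · exact ih (by have := length_out_lt hu; omega)

theorem mem_st_of_forall_le {C : Finset ℤ} {u : List ℤ} {m : ℤ} (hm : ∀ x ∈ u, x ≤ m)
    (h : m ∈ C ∨ m ∈ u) : m ∈ st C u := by
  induction u generalizing C with
  | nil => simpa [st] using h
  | cons x u ih =>
    refine ih (fun y hy => hm y (by simp [hy])) ?_
    have hx := hm x (by simp)
    rw [mem_insS]
    rcases h with h | h
    · exact Or.inl (Or.inr ⟨h, fun hb => absurd hb.2.2.1 (by omega)⟩)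
    · rcases List.mem_cons.1 h with h | h
      · exact Or.inl (Or.inl h)
      · exact Or.inr h

/-- The smallest letter of a word lies in its left key. -/
theorem mem_lkey_of_forall_le {u : List ℤ} {r : ℤ} (hr : r ∈ u) (hle : ∀ x ∈ u, r ≤ x) :
    r ∈ lkey u := by
  rw [mem_lkey]
  refine mem_st_of_forall_le (fun x hx => ?_) (Or.inr (by simpa [mem_rev]))
  have := hle _ (mem_rev.1 hx)
  omega

/-- Inserting `x` after the word `u` adds a box to the column with index `i`. -/
def Col : ℕ → List ℤ → ℤ → Prop
  | 0, u, x => insO (st ∅ u) x = none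
  | i + 1, u, x => ∃ y, insO (st ∅ u) x = some y ∧ Col i (ou ∅ u) y

theorem exists_col (u : List ℤ) (x : ℤ) : ∃ i, Col i u x := by
  induction hn : u.length using Nat.strong_induction_on generalizing u x with
  | _ n ih =>
    cases h : insO (st ∅ u) x with
    | none => exact ⟨0, h⟩
    | some y =>
      have hu : u ≠ [] := by
        rintro rfl
        simp [st, insO_of_forall_lt] at h
      obtain ⟨i, hi⟩ := ih _ (hn ▸ length_out_lt hu) (ou ∅ u) y rfl
      exact ⟨i + 1, y, h, hi⟩

theorem ou_snoc (C : Finset ℤ) (u : List ℤ) (x : ℤ) :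
    ou C (u ++ [x]) = ou C u ++ (insO (st C u) x).toList := by
  simp [ou_append, ou]

theorem st_snoc (C : Finset ℤ) (u : List ℤ) (x : ℤ) :
    st C (u ++ [x]) = insS (st C u) x := by
  simp [st_append, st]

theorem Col.keyCol {i : ℕ} {u : List ℤ} {x : ℤ} (h : Col i u x) (hr : Red (u ++ [x])) :
    (∀ j, j ≠ i → keyCol j (u ++ [x]) = keyCol j u) ∧ keyCol i u ⊆ keyCol i (u ++ [x]) ∧
      (_root_.keyCol i (u ++ [x])).card = (_root_.keyCol i u).card + 1 := by
  have hc := card_insS (st ∅ u) x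
  induction i generalizing u x with
  | zero =>
    have h0 : insO (st ∅ u) x = none := h
    have h1 : ou ∅ (u ++ [x]) = ou ∅ u := by rw [ou_snoc, h0]; simp
    refine ⟨fun j hj => ?_, lkey_subset_append _ _, ?_⟩
    · obtain ⟨j, rfl⟩ := Nat.exists_eq_succ_of_ne_zero hj
      show _root_.keyCol j _ = _root_.keyCol j _
      rw [h1]
    · show (lkey _).card = (lkey _).card + 1
      rw [card_lkey hr, card_lkey hr.left, st_snoc]
      simpa [h0] using hc
  | succ i ih =>
    obtain ⟨y, hy, hyi⟩ := h
    have h1 : ou ∅ (u ++ [x]) = ou ∅ u ++ [y] := by rw [ou_snoc, hy]; rfl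
    obtain ⟨a, b, c⟩ := ih hyi (h1 ▸ hr.out) (card_insS _ _)
    have hk : ∀ j, _root_.keyCol (j + 1) (u ++ [x]) = _root_.keyCol j (ou ∅ u ++ [y]) := fun j => by
      show _root_.keyCol j _ = _; rw [h1]
    refine ⟨fun j hj => ?_, ?_, ?_⟩
    · cases j with
      | zero =>
        refine (Finset.eq_of_subset_of_card_le (lkey_subset_append _ _) ?_).symm
        rw [card_lkey hr, card_lkey hr.left, st_snoc]
        simp [hy] at hc
        omega
      | succ j => rw [hk]; exact a j (by omega)
    · rw [hk]; exact b
    · rw [hk]; exact c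

theorem col_of_keyCol_ne {i : ℕ} {u : List ℤ} {x : ℤ} (hr : Red (u ++ [x]))
    (h : keyCol i (u ++ [x]) ≠ keyCol i u) : Col i u x := by
  obtain ⟨j, hj⟩ := exists_col u x
  by_cases hij : i = j
  · exact hij ▸ hj
  · exact absurd ((hj.keyCol hr).1 i hij) h

theorem keyCol_subset_snoc {i : ℕ} {u : List ℤ} {x : ℤ} (hr : Red (u ++ [x])) :
    keyCol i u ⊆ keyCol i (u ++ [x]) := by
  obtain ⟨j, hj⟩ := exists_col u x
  by_cases hij : i = j
  · exact hij ▸ (hj.keyCol hr).2.1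
  · rw [(hj.keyCol hr).1 i hij]

theorem keyCol_subset_append {i : ℕ} {u v : List ℤ} (hr : Red (u ++ v)) :
    keyCol i u ⊆ keyCol i (u ++ v) := by
  induction v using List.reverseRecOn with
  | nil => simp
  | append_singleton v x ih =>
    rw [← List.append_assoc] at hr ⊢
    exact (ih hr.left).trans (keyCol_subset_snoc hr)

/-- Column descents for left keys: ascents move to the right. -/
theorem Col.lt_of_lt {i j : ℕ} {u : List ℤ} {x y : ℤ} (hi : Col i u x) (hj : Col j (u ++ [x]) y)
    (hxy : x < y) : i < j := by
  induction i generalizing u x y j with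
  | zero =>
    obtain ⟨o, ho, -⟩ := insO_ascent (C := st ∅ u) hxy
    cases j with
    | zero => rw [Col, st_snoc, ho] at hj; simp at hj
    | succ j => omega
  | succ i ih =>
    obtain ⟨o, ho, hxo⟩ := insO_ascent (C := st ∅ u) hxy
    obtain ⟨o', ho', hi⟩ := hi
    cases j with
    | zero => rw [Col, st_snoc, ho] at hj; simp at hj
    | succ j =>
      obtain ⟨z, hz, hj⟩ := hj
      rw [st_snoc, ho, Option.some_inj] at hz
      subst hz
      rw [ou_snoc, ho'] at hj
      have := lt_of_insO ho'
      have := ih hi hj (by omega)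
      omega

theorem Col.le_of_lt {i j : ℕ} {u : List ℤ} {x y : ℤ} (hi : Col i u x) (hj : Col j (u ++ [x]) y)
    (hyx : y < x) : j ≤ i := by
  induction j generalizing u x y i with
  | zero => exact Nat.zero_le _
  | succ j ih =>
    obtain ⟨o, ho, hj⟩ := hj
    rw [st_snoc] at ho
    obtain ⟨o', ho', hlt⟩ := insO_descent hyx ho
    cases i with
    | zero => rw [Col, ho'] at hi; simp at hi
    | succ i =>
      obtain ⟨z, hz, hi⟩ := hi
      rw [ho', Option.some_inj] at hz
      subst hz
      rw [ou_snoc, ho'] at hj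
      have := ih hi hj hlt
      omega

theorem Red.ne {u : List ℤ} {x y : ℤ} (h : Red (u ++ [x, y])) : x ≠ y := by
  rintro rfl
  exact h _ (.refl _) u [] x (by simp)

theorem lt_of_mem_ou {C : Finset ℤ} {u : List ℤ} {o : ℤ} (h : o ∈ ou C u) : ∃ x ∈ u, o < x := by
  induction u generalizing C with
  | nil => simp [ou] at h
  | cons x u ih =>
    rw [ou, List.mem_append, Option.mem_toList] at h
    rcases h with h | h
    · exact ⟨x, by simp, lt_of_insO h⟩
    · obtain ⟨y, hy, hlt⟩ := ih h
      exact ⟨y, by simp [hy], hlt⟩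

/-- Inserting a decreasing word that replaces all the small letters of the column produces
these letters in decreasing order. -/
theorem ou_eq_cw_of_card {A S : Finset ℤ} {l : List ℤ} (hl : l.Pairwise (· > ·))
    (hAS : Disjoint A S) (hA : ∀ a ∈ A, ∀ x ∈ l, x < a) (hok : Ok (A ∪ S) l)
    (hc : (st (A ∪ S) l).card = A.card + l.length) : ou (A ∪ S) l = cw S := by
  induction l generalizing A S with
  | nil =>
    have h1 : A.card + S.card = A.card := by
      rw [← Finset.card_union_of_disjoint hAS]; simpa [st] using hc
    have h2 : S = ∅ := Finset.card_eq_zero.1 (by omega)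
    simp [ou, h2, cw_empty]
  | cons x l ih =>
    have hxA : x ∉ A := fun h => lt_irrefl _ (hA x h x (by simp))
    have hAx : ∀ a ∈ A, x < a := fun a ha => hA a ha x (by simp)
    have hlx : ∀ y ∈ l, y < x := fun y hy => List.rel_of_pairwise_cons hl hy
    have key : ∀ y ∈ S, y ≤ x → insS (A ∪ S) x = insert x A ∪ S.erase y →
        ou (insS (A ∪ S) x) l = cw (S.erase y) := by
      intro y hy hyx e
      rw [e]
      have hxy : x ∉ S.erase y → Disjoint (insert x A) (S.erase y) := fun h =>
        Finset.disjoint_insert_left.2 ⟨h, hAS.mono_right (Finset.erase_subset _ _)⟩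
      have hx' : x ∉ S.erase y := by
        intro hx
        have hx2 := Finset.mem_erase.1 hx
        have h3 : IsBumped (A ∪ S) x y ∨ y ∈ insS (A ∪ S) x := by
          by_cases hb : IsBumped (A ∪ S) x y
          · exact Or.inl hb
          · exact Or.inr (mem_insS.2 (Or.inr ⟨Finset.mem_union_right _ hy, hb⟩))
        rcases h3 with h3 | h3
        · exact h3.1 (Finset.mem_union_right _ hx2.2)
        · rw [e, Finset.mem_union, Finset.mem_insert, Finset.mem_erase] at h3
          rcases h3 with (h3 | h3) | h3
          · exact hx2.1 h3.symm
          · exact Finset.disjoint_left.1 hAS h3 hy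
          · exact h3.1 rfl
      refine ih hl.of_cons (hxy hx') ?_ (e ▸ hok.2) ?_
      · intro a ha z hz
        rcases Finset.mem_insert.1 ha with rfl | ha
        · exact hlx z hz
        · exact hA a ha z (by simp [hz])
      · rw [← e, Finset.card_insert_of_notMem hxA]
        simp only [st, List.length_cons] at hc
        omega
    rcases ins_cases (A ∪ S) x with h | ⟨y, h⟩ | h
    · exfalso
      have hxS : x ∈ S := (Finset.mem_union.1 h).resolve_left hxA
      have h1 := key x hxS le_rfl (by rw [insS_of_mem h]; ext z; grind)
      have h2 : x - 1 ∈ S := (Finset.mem_union.1 (hok.1 h)).resolve_left fun h => by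
        have := hAx _ h; omega
      have h3 : x - 1 ∈ cw (S.erase x) := mem_cw.2 (Finset.mem_erase.2 ⟨by omega, h2⟩)
      rw [← h1] at h3
      obtain ⟨z, hz, hlt⟩ := lt_of_mem_ou h3
      have := hlx z hz
      omega
    · have hyS : y ∈ S := (Finset.mem_union.1 h.2.1).resolve_left fun hy => by
        have := hAx _ hy; have := h.2.2.1; omega
      have h1 := key y hyS h.2.2.1.le (by
        rw [insS_of_isBumped h]
        have : y ∉ A := Finset.disjoint_right.1 hAS hyS
        ext z; grind)
      rw [ou, insO_of_isBumped h, h1]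
      have hmax : ∀ z ∈ S, z ≤ y := by
        intro z hz
        by_contra hyz
        have hzx : x < z := by
          by_contra hle
          have hne : z ≠ x := fun e => h.1 (e ▸ Finset.mem_union_right _ hz)
          have := h.2.2.2 z (Finset.mem_union_right _ hz) (by omega)
          omega
        have hsub : A ∪ (x :: l).toFinset ⊆ st (A ∪ S) (x :: l) := by
          intro w hw
          rcases Finset.mem_union.1 hw with hw | hw
          · exact mem_st_of_forall_le (fun v hv => (hA w hw v hv).le)
              (Or.inl (Finset.mem_union_left _ hw))
          · rw [List.mem_toFinset] at hw
            obtain ⟨l1, l2, e⟩ := List.append_of_mem hw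
            rw [e, st_append]
            refine mem_st_of_forall_le (fun v hv => ?_) (Or.inr (by simp))
            rw [e] at hl
            rcases List.mem_cons.1 hv with rfl | hv
            · exact le_rfl
            · exact (List.rel_of_pairwise_cons (List.pairwise_append.1 hl).2.1 hv).le
        have hcard : (A ∪ (x :: l).toFinset).card = A.card + (x :: l).length := by
          rw [Finset.card_union_of_disjoint, List.toFinset_card_of_nodup]
          · exact hl.imp fun h => ne_of_gt h
          · rw [Finset.disjoint_left]
            intro a ha ha'
            exact lt_irrefl _ (hA a ha a (List.mem_toFinset.1 ha'))
        have heq := Finset.eq_of_subset_of_card_le hsub (by rw [hc, hcard])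
        have hz' : z ∈ st (A ∪ S) (x :: l) := by
          refine mem_st_of_forall_le (fun v hv => ?_) (Or.inl (Finset.mem_union_right _ hz))
          rcases List.mem_cons.1 hv with rfl | hv
          · exact hzx.le
          · have := hlx v hv; omega
        rw [← heq, Finset.mem_union, List.mem_toFinset, List.mem_cons] at hz'
        rcases hz' with hz' | hz' | hz'
        · exact Finset.disjoint_left.1 hAS hz' hz
        · omega
        · have := hlx z hz'; omega
      refine (cw_eq ?_ fun z => ?_).symm
      · simp only [Option.toList_some, List.singleton_append, List.pairwise_cons]
        refine ⟨fun z hz => ?_, pairwise_cw _⟩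
        have hz := Finset.mem_erase.1 (mem_cw.1 hz)
        exact lt_of_le_of_ne (hmax z hz.2) hz.1
      · simp only [Option.toList_some, List.singleton_append, List.mem_cons, mem_cw,
          Finset.mem_erase]
        grind
    · obtain ⟨h1, -⟩ := st_decreasing (C := A ∪ S) hl fun z hz c hcm => by
        have := h c hcm
        rcases List.mem_cons.1 hz with rfl | hz
        · exact this
        · exact (hlx z hz).trans this
      have h2 := card_st (A ∪ S) (x :: l)
      rw [h1, hc, Finset.card_union_of_disjoint hAS, List.length_nil] at h2
      have h3 : S = ∅ := Finset.card_eq_zero.1 (by omega)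
      rw [h1, h3, cw_empty]

theorem length_ou_of_decreasing {D : Finset ℤ} {l : List ℤ} {m : ℤ}
    (hl : (l ++ [m]).Pairwise (· > ·)) (h : insO (st D l) m ≠ none) :
    (ou D (l ++ [m])).length = l.length + 1 := by
  obtain ⟨o, ho⟩ := Option.ne_none_iff_exists'.1 h
  induction l using List.reverseRecOn generalizing m o with
  | nil => simp only [ou, st, List.nil_append] at ho ⊢; simp [ho]
  | append_singleton l a ih =>
    rw [st_snoc] at ho
    have ham : m < a := (List.pairwise_append.1 hl).2.2 a (by simp) m (by simp)
    obtain ⟨o', ho', -⟩ := insO_descent ham ho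
    have := ih (hl.sublist (by simp)) (by simp [ho']) _ ho'
    rw [ou_snoc, st_snoc, ho]
    simp [this]

theorem exists_snoc_col_zero {u : List ℤ} (hu : Red u)
    (h : (keyCol 1 u).card < (keyCol 0 u).card) : ∃ v x, CK u (v ++ [x]) ∧ Col 0 v x := by
  have h1 : (st ∅ (ou ∅ u)).card < (st ∅ u).card := by
    rwa [← card_lkey hu, ← card_lkey hu.out]
  have hne : cw (st ∅ u) ≠ [] := by
    intro e
    have := length_cw (st ∅ u)
    simp [e] at this
    omega
  obtain ⟨l, m, hlm⟩ : ∃ l m, cw (st ∅ u) = l ++ [m] :=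
    ⟨_, _, (List.dropLast_append_getLast hne).symm⟩
  refine ⟨ou ∅ u ++ l, m, ?_, ?_⟩
  · rw [List.append_assoc, ← hlm]
    exact ck_out hu
  · by_contra hcon
    have hp := pairwise_cw (st ∅ u)
    rw [hlm] at hp
    have h2 := length_ou_of_decreasing (D := st ∅ (ou ∅ u)) hp (by rwa [← st_append])
    have h3 := card_st (st ∅ (ou ∅ u)) (l ++ [m])
    rw [← hlm, ← st_append, ← (ck_invariant (ck_out hu) hu).1, hlm, h2] at h3
    simp at h3
    omega

theorem rev_cw (C : Finset ℤ) : rev (cw C) = cw (C.image Neg.neg) := by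
  refine (cw_eq (rev_pairwise (pairwise_cw C)) fun x => ?_).symm
  rw [mem_rev, mem_cw, Finset.mem_image]
  exact ⟨fun h => ⟨_, h, by simp⟩, by rintro ⟨y, hy, rfl⟩; simpa using hy⟩

/-- If the left key has more letters in its column `i` than in its column `i + 1`, the word
is equivalent to a word whose last letter adds to column `i`. -/
theorem exists_snoc_col {i : ℕ} {u : List ℤ} (hu : Red u)
    (h : (keyCol (i + 1) u).card < (keyCol i u).card) : ∃ v x, CK u (v ++ [x]) ∧ Col i v x := by
  induction i generalizing u with
  | zero => exact exists_snoc_col_zero hu h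
  | succ i ih =>
    obtain ⟨G, y, hG, hy⟩ := ih hu.out h
    set C := st ∅ u with hC
    have h1 : CK u (G ++ [y] ++ cw C) := (ck_out hu).trans (hG.append_right _)
    have h2 : ∃ c ∈ C, y ≤ c := by
      by_contra! hcon
      have hp : (y :: cw C).Pairwise (· > ·) :=
        List.pairwise_cons.2 ⟨fun c hc => hcon c (mem_cw.1 hc), pairwise_cw C⟩
      have h1' : CK u (G ++ y :: cw C) := by simpa using h1
      have := length_le_card_st (hu.congr h1') hp
      rw [← (ck_invariant h1' hu).1, ← hC, List.length_cons, length_cw] at this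
      omega
    obtain ⟨c, hc, hyc⟩ := h2
    set D := C.image Neg.neg
    have hr : Red (cw D ++ [-y]) := by
      have := (hu.congr h1).rev
      rw [rev_append, rev_append, rev_cw, ← List.append_assoc] at this
      exact this.left
    have h3 := ck_cw_append (sub_one_mem_of_red hr)
    obtain ⟨o, ho⟩ := insO_ne_none (C := D) (p := -c) (x := -y)
      (Finset.mem_image_of_mem _ hc) (by omega)
    have h4 := h3.rev
    have h5 : rev (cw D) = cw C := by rw [← rev_cw, rev_rev]
    rw [ho, rev_append, rev_append, h5] at h4
    set l := rev (cw (insS D (-y)))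
    have hl : l.Pairwise (· > ·) := rev_pairwise (pairwise_cw _)
    have hlen : l.length = C.card := by
      have := card_insS D (-y)
      have hD : D.card = C.card := Finset.card_image_of_injective _ neg_injective
      rw [ho] at this
      rw [length_rev, length_cw]
      simp at this
      omega
    have h6 : CK (y :: cw C) (l ++ [-o]) := by
      have e1 : rev [-y] = [y] := by simp [rev]
      have e2 : rev (some o).toList = [-o] := by simp [rev]
      rwa [e1, e2] at h4
    have h7 : CK u (G ++ l ++ [-o]) := by
      have := h6.append_left G
      simp only [List.append_assoc] at this h1 ⊢
      exact h1.trans this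
    have hr7 := hu.congr h7
    have hst : (st (st ∅ G) l).card = l.length := by
      refine le_antisymm ?_ ?_
      · have e := (ck_invariant h7 hu).1
        rw [st_snoc, st_append] at e
        have := card_le_card_insS (st (st ∅ G) l) (-o)
        rw [← e, ← hC] at this
        omega
      · rw [← st_append]
        exact length_le_card_st hr7.left hl
    have hok : Ok (st ∅ G) l := (ok_append.1 hr7.left.ok_empty).2
    have hou : ou (st ∅ G) l = cw (st ∅ G) := by
      simpa using ou_eq_cw_of_card (A := ∅) (S := st ∅ G) hl (by simp) (by simp) (by simpa using hok)
        (by simpa using hst)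
    have hrG : Red (G ++ [y]) := hu.out.congr hG
    have h8 : keyCol (i + 1) (G ++ l) = keyCol i G := by
      show keyCol i (ou ∅ (G ++ l)) = _
      rw [ou_append, hou]
      exact (keyCol_congr (ck_out hrG.left) hrG.left).symm
    refine ⟨G ++ l, -o, h7, col_of_keyCol_ne hr7 fun e => ?_⟩
    rw [← keyCol_congr h7 hu, h8, show keyCol (i + 1) u = keyCol i (ou ∅ u) from rfl,
      keyCol_congr hG hu.out] at e
    have := (hy.keyCol hrG).2.2
    rw [e] at this
    omega

/-- The number of columns of the left key containing `r`. -/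
def cnt (r : ℤ) (u : List ℤ) : ℕ := sInf {i | r ∉ keyCol i u}

theorem mem_keyCol_iff {r : ℤ} {i : ℕ} {u : List ℤ} (h : Red u) :
    r ∈ keyCol i u ↔ i < cnt r u := by
  constructor
  · intro hr
    by_contra hle
    have hne : {i | r ∉ keyCol i u}.Nonempty :=
      ⟨u.length, by simp [keyCol_eq_empty (le_refl u.length)]⟩
    exact Nat.sInf_mem hne (keyCol_anti (not_lt.1 hle) h hr)
  · intro hlt
    by_contra hr
    exact Nat.notMem_of_lt_sInf hlt hr

theorem cnt_congr {r : ℤ} {u v : List ℤ} (h : CK u v) (hu : Red u) : cnt r u = cnt r v := by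
  simp only [cnt, keyCol_congr h hu]

theorem cnt_le_of_forall {r : ℤ} {u v : List ℤ} (hu : Red u) (hv : Red v)
    (h : ∀ i, r ∈ keyCol i u → r ∈ keyCol i v) : cnt r u ≤ cnt r v := by
  by_contra hlt
  exact lt_irrefl _ ((mem_keyCol_iff hv).1 (h _ ((mem_keyCol_iff hu).2 (not_le.1 hlt))))

theorem cnt_snoc_le {r : ℤ} {u : List ℤ} {x : ℤ} (h : Red (u ++ [x])) :
    cnt r (u ++ [x]) ≤ cnt r u + 1 := by
  obtain ⟨i, hi⟩ := exists_col u x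
  have hk := (hi.keyCol h).1
  by_contra! hlt
  by_cases hic : i = cnt r u
  · have h1 : r ∈ keyCol (cnt r u + 1) (u ++ [x]) := (mem_keyCol_iff h).2 hlt
    rw [hk _ (by omega), mem_keyCol_iff h.left] at h1
    omega
  · have h1 : r ∈ keyCol (cnt r u) (u ++ [x]) := (mem_keyCol_iff h).2 (by omega)
    rw [hk _ (by omega), mem_keyCol_iff h.left] at h1
    omega

theorem cnt_eq_zero_of_notMem {r : ℤ} {u : List ℤ} (h : Red u) (hr : r ∉ u) : cnt r u = 0 := by
  by_contra h0
  exact hr (mem_of_mem_keyCol h ((mem_keyCol_iff h).2 (Nat.pos_of_ne_zero h0)))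

theorem cnt_append_le {r : ℤ} {u v : List ℤ} (h : Red (u ++ v)) (hr : r ∉ u) :
    cnt r (u ++ v) ≤ v.length := by
  induction v using List.reverseRecOn with
  | nil => simpa using (cnt_eq_zero_of_notMem h.left hr).le
  | append_singleton v x ih =>
    rw [← List.append_assoc] at h ⊢
    have := cnt_snoc_le (r := r) h
    have := ih h.left
    simp only [List.length_append, List.length_singleton]
    omega

/-- A word splits at `r` if it is equivalent to a word of letters larger than `r` followed by
an increasing word with as many letters as there are columns of the left key containing `r`. -/
def SplitsAt (r : ℤ) (u : List ℤ) : Prop :=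
  ∃ τ υ, CK u (τ ++ υ) ∧ (∀ x ∈ τ, r < x) ∧ υ.length = cnt r u ∧ υ.Pairwise (· < ·)

theorem notMem_keyCol_of_col {r : ℤ} {i : ℕ} {u : List ℤ} {x : ℤ} (hr : Red (u ++ [x]))
    (hs : ∀ v, v.length ≤ u.length → Red v → (∀ y ∈ v, r ≤ y) → SplitsAt r v)
    (hle : ∀ y ∈ u ++ [x], r ≤ y) (hcol : Col i u x) (hcnt : cnt r (u ++ [x]) = i + 1) :
    r ∉ keyCol i u := by
  induction i generalizing u x with
  | zero =>
    intro hmem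
    obtain ⟨τ, υ, hck, hτ, hlen, -⟩ := hs u le_rfl hr.left fun y hy => hle y (by simp [hy])
    have h1 : cnt r u ≤ 1 := by
      have := cnt_le_of_forall (r := r) hr.left hr fun i hi => keyCol_subset_snoc hr hi
      omega
    have h2 : 0 < cnt r u := (mem_keyCol_iff hr.left).1 hmem
    obtain ⟨a, rfl⟩ := List.length_eq_one_iff.1 (show υ.length = 1 by omega)
    have h3 : r ∈ τ ++ [a] := (hck.mem_iff r).1 (mem_of_mem_keyCol hr.left hmem)
    obtain rfl : r = a := by
      rcases List.mem_append.1 h3 with h3 | h3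
      · exact absurd (hτ r h3) (lt_irrefl r)
      · simpa using h3
    have h4 : Red (τ ++ [r] ++ [x]) := hr.congr (hck.append_right [x])
    have hrx : r < x := lt_of_le_of_ne (hle x (by simp)) (Red.ne (u := τ) (by simpa using h4))
    obtain ⟨o, ho, -⟩ := insO_ascent (C := st ∅ τ) hrx
    rw [Col, (ck_invariant hck hr.left).1, st_snoc, ho] at hcol
    simp at hcol
  | succ i ih =>
    obtain ⟨y, hy, hcol⟩ := hcol
    have h1 : ou ∅ (u ++ [x]) = ou ∅ u ++ [y] := by rw [ou_snoc, hy]; rfl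
    have hu : u ≠ [] := by
      rintro rfl
      simp [st, insO_of_forall_lt] at hy
    have hr' := hr.out
    have hl := length_out_lt hu
    refine ih (x := y) (h1 ▸ hr') (fun v hv => hs v (by omega)) (fun z hz => ?_) hcol ?_
    · refine hle z (((ck_out hr).mem_iff z).2 ?_)
      rw [h1]
      exact List.mem_append_left _ hz
    · rw [← h1]
      have h2 : ∀ j, j < cnt r (ou ∅ (u ++ [x])) ↔ j + 1 < cnt r (u ++ [x]) := fun j => by
        rw [← mem_keyCol_iff hr', ← mem_keyCol_iff hr]; rfl
      have h3 := h2 i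
      have h4 := h2 (i + 1)
      omega

theorem splitsAt {r : ℤ} {u : List ℤ} (hu : Red u) (hle : ∀ y ∈ u, r ≤ y) : SplitsAt r u := by
  induction hn : u.length using Nat.strong_induction_on generalizing u with
  | _ n ih =>
  rcases hc : cnt r u with _ | i
  · refine ⟨u, [], by simpa using CtxEquiv.refl u, fun x hx => ?_, by simp [hc], by simp⟩
    refine lt_of_le_of_ne (hle x hx) ?_
    rintro rfl
    have : 0 < cnt r u := (mem_keyCol_iff hu).1 (mem_lkey_of_forall_le hx hle)
    omega
  · have h1 : (keyCol (i + 1) u).card < (keyCol i u).card := by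
      refine Finset.card_lt_card ⟨keyCol_succ_subset hu, fun hsub => ?_⟩
      have := (mem_keyCol_iff hu).1 (hsub ((mem_keyCol_iff hu).2 (by omega : i < cnt r u)))
      omega
    obtain ⟨v, x, hv, hcol⟩ := exists_snoc_col hu h1
    have hr := hu.congr hv
    have hle' : ∀ y ∈ v ++ [x], r ≤ y := fun y hy => hle y ((hv.mem_iff y).2 hy)
    have hlen := hv.length_eq
    simp only [List.length_append, List.length_singleton] at hlen
    have hnot := notMem_keyCol_of_col hr (fun w hw hw1 hw2 => ih w.length (by omega) hw1 hw2 rfl)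
      hle' hcol (by rw [← cnt_congr hv hu, hc])
    have hk := (hcol.keyCol hr).1
    have hcv : cnt r v = i := by
      rw [mem_keyCol_iff hr.left] at hnot
      by_contra hne
      have : r ∈ keyCol (cnt r v) (v ++ [x]) :=
        (mem_keyCol_iff hr).2 (by rw [← cnt_congr hv hu]; omega)
      rw [hk _ (by omega), mem_keyCol_iff hr.left] at this
      omega
    obtain ⟨τ, υ, hck, hτ, hυ, hinc⟩ :=
      ih v.length (by omega) hr.left (fun y hy => hle' y (by simp [hy])) rfl
    have hck' : CK u (τ ++ (υ ++ [x])) := by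
      rw [← List.append_assoc]; exact hv.trans (hck.append_right [x])
    refine ⟨τ, υ ++ [x], hck', hτ, by simp [hυ, hcv, hc], ?_⟩
    rcases List.eq_nil_or_concat υ with rfl | ⟨υ', y, rfl⟩
    · simp
    have hr2 : Red (τ ++ υ' ++ [y] ++ [x]) := by simpa using hu.congr hck'
    have hyx : y < x := by
      by_contra hlt
      have hne : y ≠ x := Red.ne (u := τ ++ υ') (by simpa using hr2)
      obtain ⟨j, hj⟩ := exists_col (τ ++ υ') y
      have hcol2 : Col i (τ ++ υ' ++ [y]) x := by
        refine col_of_keyCol_ne hr2 fun e => ?_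
        have e1 := (hcol.keyCol hr).2.2
        rw [keyCol_congr (hck.append_right [x]) hr, keyCol_congr hck hr.left] at e1
        simp only [List.append_assoc, List.concat_eq_append] at e e1
        rw [e] at e1
        omega
      have hij : i ≤ j := hj.le_of_lt hcol2 (by omega)
      have h2 := cnt_append_le (r := r) hr2.left.left fun h => lt_irrefl _ (hτ r h)
      have hi : i = υ'.length + 1 := by simpa [hcv, eq_comm] using hυ
      have h3 : υ'.length ∈ {k | k < cnt r (τ ++ υ' ++ [y])} := by
        have := cnt_congr (r := r) hck hr.left
        simp only [List.concat_eq_append, ← List.append_assoc] at this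
        show υ'.length < cnt r (τ ++ υ' ++ [y])
        omega
      have h4 : r ∈ keyCol υ'.length (τ ++ υ' ++ [y]) := (mem_keyCol_iff hr2.left).2 h3
      rw [(hj.keyCol hr2.left).1 _ (by omega), mem_keyCol_iff hr2.left.left] at h4
      omega
    rw [List.concat_eq_append] at hinc ⊢
    rw [List.pairwise_append] at hinc ⊢
    refine ⟨List.pairwise_append.2 hinc, by simp, fun a ha b hb => ?_⟩
    obtain rfl := List.mem_singleton.1 hb
    rcases List.mem_append.1 ha with ha | ha
    · exact (hinc.2.2 a ha y (by simp)).trans hyx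
    · obtain rfl := List.mem_singleton.1 ha
      exact hyx

theorem cnt_le_length {r : ℤ} {u : List ℤ} : cnt r u ≤ u.length :=
  Nat.sInf_le (by simp [keyCol_eq_empty (le_refl u.length)])

theorem sum_cnt {S : Finset ℤ} {u : List ℤ} (hu : Red u) (hS : ∀ x ∈ u, x ∈ S) :
    ∑ r ∈ S, cnt r u = u.length := by
  have h1 : ∀ r, cnt r u = ∑ i ∈ Finset.range u.length, if r ∈ keyCol i u then 1 else 0 := by
    intro r
    rw [← Finset.card_filter]
    have : (Finset.range u.length).filter (fun i => r ∈ keyCol i u) = Finset.range (cnt r u) := by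
      ext i
      rw [Finset.mem_filter, mem_keyCol_iff hu, Finset.mem_range, Finset.mem_range]
      have := cnt_le_length (r := r) (u := u)
      omega
    rw [this, Finset.card_range]
  simp_rw [h1]
  rw [Finset.sum_comm]
  refine Eq.trans (Finset.sum_congr rfl fun i _ => ?_) (sum_card_keyCol hu le_rfl)
  rw [← Finset.card_filter]
  congr 1
  ext r
  rw [Finset.mem_filter]
  exact ⟨fun h => h.2, fun h => ⟨hS r (mem_of_mem_keyCol hu h), h⟩⟩

theorem cnt_left_le {r : ℤ} {u v : List ℤ} (h : Red (u ++ v)) : cnt r u ≤ cnt r (u ++ v) :=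
  cnt_le_of_forall h.left h fun _ hi => keyCol_subset_append h hi

/-- Splitting off the letter `r` does not change the multiplicities of the other letters. -/
theorem cnt_eq_of_split {r s : ℤ} {u v : List ℤ} (h : Red (u ++ v)) (hr : r ∉ u)
    (hv : v.length = cnt r (u ++ v)) (hs : s ≠ r) : cnt s u = cnt s (u ++ v) := by
  set S : Finset ℤ := insert s (insert r (u ++ v).toFinset) with hS
  have hrS : r ∈ S := by simp [hS]
  have h1 := sum_cnt h (S := S) fun x hx => by
    rw [hS, Finset.mem_insert, Finset.mem_insert, List.mem_toFinset]; tauto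
  have h2 := sum_cnt h.left (S := S) fun x hx => by
    rw [hS, Finset.mem_insert, Finset.mem_insert, List.mem_toFinset, List.mem_append]; tauto
  rw [← Finset.sum_erase_add _ _ hrS] at h1 h2
  rw [cnt_eq_zero_of_notMem h.left hr] at h2
  rw [List.length_append] at h1
  have h3 : ∑ x ∈ S.erase r, cnt x u = ∑ x ∈ S.erase r, cnt x (u ++ v) := by omega
  exact (Finset.sum_eq_sum_iff_of_le fun x _ => cnt_left_le h).1 h3 s
    (Finset.mem_erase.2 ⟨hs, hS ▸ Finset.mem_insert_self _ _⟩)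

/-- A factorization of a word into the rows of a tableau, listed from top to bottom, where the
row of index `r` has `m r` letters and starts with `r`. -/
structure IsRows (m : ℤ → ℕ) (bs : List (List ℤ)) : Prop where
  ne_nil : ∀ b ∈ bs, b ≠ []
  increasing : ∀ b ∈ bs, b.Pairwise (· < ·)
  heads : (bs.map List.headI).Pairwise (· > ·)
  length_eq : ∀ b ∈ bs, b.length = m b.headI
  exists_row : ∀ r, m r ≠ 0 → ∃ b ∈ bs, b.headI = r

theorem exists_isRows {u : List ℤ} (hu : Red u) :
    ∃ bs : List (List ℤ), CK u bs.flatten ∧ IsRows (fun r => cnt r u) bs := by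
  induction hn : u.length using Nat.strong_induction_on generalizing u with
  | _ n ih =>
  by_cases hnil : u = []
  · subst hnil
    refine ⟨[], .refl _, by simp, by simp, by simp, by simp, fun r hr => absurd ?_ hr⟩
    exact cnt_eq_zero_of_notMem hu (by simp)
  have hne : u.toFinset.Nonempty := by
    obtain ⟨x, hx⟩ := List.exists_mem_of_ne_nil u hnil
    exact ⟨x, by simpa using hx⟩
  obtain ⟨r, hr, hmin⟩ := u.toFinset.exists_min_image id hne
  simp only [List.mem_toFinset, id] at hr hmin
  obtain ⟨τ, υ, hck, hτ, hlen, hinc⟩ := splitsAt hu hmin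
  have hpos : 0 < cnt r u := (mem_keyCol_iff hu).1 (mem_lkey_of_forall_le hr hmin)
  have hred := hu.congr hck
  have hrτ : r ∉ τ := fun h => lt_irrefl _ (hτ r h)
  have hl := hck.length_eq
  rw [List.length_append] at hl
  obtain ⟨bs, hbs, hrows⟩ := ih τ.length (by omega) hred.left rfl
  have hcnt : ∀ s, s ≠ r → cnt s τ = cnt s u := fun s hs => by
    rw [cnt_congr hck hu]
    exact cnt_eq_of_split hred hrτ (by rw [hlen, cnt_congr hck hu]) hs
  have hhead : υ.headI = r := by
    cases υ with
    | nil => simp at hlen; omega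
    | cons a υ =>
      have h1 : r ∈ a :: υ := (List.mem_append.1 ((hck.mem_iff r).1 hr)).resolve_left hrτ
      have h2 : r ≤ a := hmin a ((hck.mem_iff a).2 (by simp))
      rcases List.mem_cons.1 h1 with h1 | h1
      · exact h1.symm
      · have := List.rel_of_pairwise_cons hinc h1
        omega
  have hheads : ∀ b ∈ bs, r < b.headI := fun b hb => by
    refine hτ _ ((hbs.mem_iff _).2 (List.mem_flatten.2 ⟨b, hb, ?_⟩))
    have := hrows.ne_nil b hb
    cases b with
    | nil => exact absurd rfl this
    | cons a b => simp
  refine ⟨bs ++ [υ], ?_, ⟨?_, ?_, ?_, ?_, ?_⟩⟩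
  · rw [List.flatten_append]
    simpa using hck.trans (hbs.append_right υ)
  · intro b hb
    rcases List.mem_append.1 hb with hb | hb
    · exact hrows.ne_nil b hb
    · obtain rfl := List.mem_singleton.1 hb
      rintro rfl
      simp at hlen
      omega
  · intro b hb
    rcases List.mem_append.1 hb with hb | hb
    · exact hrows.increasing b hb
    · obtain rfl := List.mem_singleton.1 hb
      exact hinc
  · rw [List.map_append, List.pairwise_append]
    refine ⟨hrows.heads, by simp, ?_⟩
    simpa [hhead] using hheads
  · intro b hb
    rcases List.mem_append.1 hb with hb | hb
    · rw [hrows.length_eq b hb]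
      exact hcnt _ (hheads b hb).ne'
    · obtain rfl := List.mem_singleton.1 hb
      rw [hhead, hlen]
  · intro s hs
    by_cases hsr : s = r
    · exact ⟨υ, by simp, by rw [hhead, hsr]⟩
    · obtain ⟨b, hb, e⟩ := hrows.exists_row s (by rwa [hcnt s hsr])
      exact ⟨b, by simp [hb], e⟩

/-- The number of letters of a left factor whose letters lie in `S` is bounded. -/
theorem length_left_le {S : Finset ℤ} {u v w : List ℤ} (hu : Red u) (h : CK u (v ++ w))
    (hS : ∀ x ∈ v, x ∈ S) : v.length ≤ ∑ r ∈ S, cnt r u := by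
  have hr := hu.congr h
  rw [← sum_cnt hr.left hS]
  refine Finset.sum_le_sum fun r _ => ?_
  rw [cnt_congr h hu]
  exact cnt_left_le hr

/-- A word of natural numbers as an integer word. -/
def intWord (u : List ℕ) : List ℤ := u.map Nat.cast

/-- The word of natural numbers underlying a nonnegative integer word. -/
def natWord (u : List ℤ) : List ℕ := u.map Int.toNat

theorem intWord_append (u v : List ℕ) : intWord (u ++ v) = intWord u ++ intWord v := List.map_append

theorem natWord_append (u v : List ℤ) : natWord (u ++ v) = natWord u ++ natWord v := List.map_append

theorem natWord_intWord (u : List ℕ) : natWord (intWord u) = u := by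
  simp [natWord, intWord, List.map_map, Function.comp_def]

theorem PosWord.one_le {u : List ℕ} (h : PosWord u) : ∀ x ∈ intWord u, 1 ≤ x := by
  intro x hx
  obtain ⟨y, hy, rfl⟩ := List.mem_map.1 hx
  exact_mod_cast h y hy

theorem posWord_natWord {u : List ℤ} (h : ∀ x ∈ u, 1 ≤ x) : PosWord (natWord u) := by
  intro y hy
  obtain ⟨x, hx, rfl⟩ := List.mem_map.1 hy
  have := h x hx
  omega

theorem CKEquiv.ck {u v : List ℕ} (h : CKEquiv u v) : CK (intWord u) (intWord v) := by
  induction h with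
  | rel u v h =>
    rcases h with ⟨a, b, x, y, z, h1, h2, rfl, rfl⟩ | ⟨a, b, x, y, z, h1, h2, rfl, rfl⟩ |
      ⟨a, b, i, rfl, rfl⟩ <;> simp only [intWord_append] <;> refine CtxEquiv.context ?_ _ _
    · exact CtxEquiv.of_move (CKMove.low x y z (by exact_mod_cast h1) (by exact_mod_cast h2))
    · exact CtxEquiv.of_move (CKMove.high x y z (by exact_mod_cast h1) (by exact_mod_cast h2))
    · simpa [intWord] using CtxEquiv.of_move (CKMove.braid i)
  | refl u => exact .refl _
  | symm _ _ _ ih => exact ih.symm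
  | trans _ _ _ _ _ ih ih' => exact ih.trans ih'

theorem ckEquiv_natWord {u v : List ℤ} (h : CK u v) (hu : ∀ x ∈ u, 1 ≤ x) :
    CKEquiv (natWord u) (natWord v) := by
  have key : ((∀ x ∈ u, 1 ≤ x) ↔ ∀ x ∈ v, 1 ≤ x) ∧
      ((∀ x ∈ u, 1 ≤ x) → CKEquiv (natWord u) (natWord v)) := by
    refine CtxEquiv.lift (S := fun u v => ((∀ x ∈ u, 1 ≤ x) ↔ ∀ x ∈ v, 1 ≤ x) ∧
      ((∀ x ∈ u, 1 ≤ x) → CKEquiv (natWord u) (natWord v))) ⟨?_, ?_, ?_⟩ (fun a b t t' ht => ?_) h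
    · exact fun u => ⟨Iff.rfl, fun _ => .refl _⟩
    · exact fun h => ⟨h.1.symm, fun hv => .symm _ _ (h.2 (h.1.2 hv))⟩
    · exact fun h h' => ⟨h.1.trans h'.1, fun hv => .trans _ _ _ (h.2 hv) (h'.2 (h.1.1 hv))⟩
    · have hmem := CK.mem_iff ((CtxEquiv.of_move ht).context a b)
      refine ⟨by simp only [hmem], fun hp => .rel _ _ ?_⟩
      simp only [natWord_append]
      simp only [List.mem_append] at hp
      cases ht with
      | low x y z h1 h2 =>
        have hy := hp y (by simp)
        exact Or.inl ⟨_, _, x.toNat, y.toNat, z.toNat, by omega, by omega, rfl, rfl⟩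
      | high x y z h1 h2 =>
        have hy := hp y (by simp)
        exact Or.inr (Or.inl ⟨_, _, x.toNat, y.toNat, z.toNat, by omega, by omega, rfl, rfl⟩)
      | braid i =>
        have hi := hp i (by simp)
        refine Or.inr (Or.inr ⟨natWord a, natWord b, i.toNat, ?_⟩)
        simp [natWord, Int.toNat_add (show 0 ≤ i by omega)]
  exact key.2 hu

theorem wordPerm_append (u v : List ℕ) : wordPerm (u ++ v) = wordPerm u * wordPerm v := by
  simp [wordPerm]

theorem wordPerm_cox {u v : List ℤ} (h : Cox u v) (hu : ∀ x ∈ u, 1 ≤ x) :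
    (∀ x ∈ v, 1 ≤ x) ∧ v.length = u.length ∧ wordPerm (natWord v) = wordPerm (natWord u) := by
  have key : ((∀ x ∈ u, 1 ≤ x) ↔ ∀ x ∈ v, 1 ≤ x) ∧ v.length = u.length ∧
      ((∀ x ∈ u, 1 ≤ x) → wordPerm (natWord v) = wordPerm (natWord u)) := by
    refine CtxEquiv.lift (S := fun u v => ((∀ x ∈ u, 1 ≤ x) ↔ ∀ x ∈ v, 1 ≤ x) ∧
      v.length = u.length ∧ ((∀ x ∈ u, 1 ≤ x) → wordPerm (natWord v) = wordPerm (natWord u)))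
      ⟨?_, ?_, ?_⟩ (fun a b t t' ht => ?_) h
    · exact fun u => ⟨Iff.rfl, rfl, fun _ => rfl⟩
    · exact fun h => ⟨h.1.symm, h.2.1.symm, fun hv => (h.2.2 (h.1.2 hv)).symm⟩
    · exact fun h h' => ⟨h.1.trans h'.1, h'.2.1.trans h.2.1,
        fun hv => (h'.2.2 (h.1.1 hv)).trans (h.2.2 hv)⟩
    · have hmem : ∀ x, x ∈ t ↔ x ∈ t' := fun x => by
        cases ht <;> simp only [List.mem_cons, List.not_mem_nil] <;> tauto
      refine ⟨by simp only [List.mem_append, hmem], by cases ht <;> simp, fun hp => ?_⟩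
      simp only [List.mem_append] at hp
      simp only [natWord_append, wordPerm_append]
      congr 2
      cases ht with
      | comm i j hij =>
        have hi := hp i (by simp)
        simp only [natWord, wordPerm, sPerm, List.map_cons, List.map_nil, List.prod_cons,
          List.prod_nil, mul_one]
        refine (Equiv.Perm.Disjoint.commute fun x => ?_).eq
        by_cases h1 : x = i.toNat ∨ x = i.toNat + 1
        · exact Or.inl (Equiv.swap_apply_of_ne_of_ne (by omega) (by omega))
        · exact Or.inr (Equiv.swap_apply_of_ne_of_ne (by omega) (by omega))
      | braid i =>
        have hi := hp i (by simp)
        simp only [natWord, wordPerm, sPerm, List.map_cons, List.map_nil, List.prod_cons,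
          List.prod_nil, mul_one, Int.toNat_add (show 0 ≤ i by omega) zero_le_one, Int.toNat_one]
        generalize i.toNat = n
        rw [← mul_assoc, ← mul_assoc, Equiv.swap_mul_swap_mul_swap (by omega) (by omega),
          Equiv.swap_comm n (n + 1), Equiv.swap_comm (n + 1) (n + 1 + 1),
          Equiv.swap_mul_swap_mul_swap (by omega) (by omega), Equiv.swap_comm]
  exact ⟨key.1.1 hu, key.2.1, key.2.2 hu⟩

theorem IsReducedWord.red {u : List ℕ} (h : IsReducedWord u) : Red (intWord u) := by
  rintro v hv a b x rfl
  obtain ⟨hpos, hlen, hw⟩ := wordPerm_cox hv h.1.one_le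
  have hpos' : ∀ y ∈ a ++ b, 1 ≤ y := fun y hy => hpos y (by simp at hy ⊢; tauto)
  have hx : wordPerm (natWord [x, x]) = 1 := by simp [natWord, wordPerm, sPerm]
  have := h.2 (natWord (a ++ b)) (posWord_natWord hpos') (by
    rw [natWord_intWord] at hw
    rw [← hw]
    simp only [natWord_append, wordPerm_append, hx, mul_one])
  simp [natWord, intWord] at this hlen
  omega

theorem IsReducedWord.congr {u v : List ℕ} (h : IsReducedWord u) (huv : CKEquiv u v) :
    IsReducedWord v := by
  obtain ⟨hpos, hlen, hw⟩ := wordPerm_cox huv.ck.cox h.1.one_le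
  rw [natWord_intWord, natWord_intWord] at hw
  have hpv := posWord_natWord hpos
  rw [natWord_intWord] at hpv
  refine ⟨hpv, fun σ hσ e => ?_⟩
  have := h.2 σ hσ (e.trans hw)
  simp [intWord] at hlen
  omega

theorem IsReducedWord.left {u v : List ℕ} (h : IsReducedWord (u ++ v)) : IsReducedWord u := by
  refine ⟨fun x hx => h.1 x (by simp [hx]), fun σ hσ e => ?_⟩
  have := h.2 (σ ++ v) (fun x hx => ?_) (by rw [wordPerm_append, wordPerm_append, e])
  · simpa using this
  · rcases List.mem_append.1 hx with hx | hx
    · exact hσ x hx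
    · exact h.1 x (by simp [hx])

theorem runFact_cons_cons (a : ℕ) {w : List ℕ} {r : List ℕ} {rs : List (List ℕ)}
    (h : runFact w = r :: rs) :
    runFact (a :: w) = if a < r.headI then (a :: r) :: rs else [a] :: r :: rs := by
  rw [runFact, h]

theorem runFact_cons_nil (a : ℕ) {w : List ℕ} (h : runFact w = []) :
    runFact (a :: w) = [[a]] := by
  rw [runFact, h]

theorem runFact_append {b w : List ℕ} (hb : b ≠ []) (hinc : b.Pairwise (· < ·))
    (h : ∀ c ∈ (runFact w).head?, c.headI ≤ b.headI) : runFact (b ++ w) = b :: runFact w := by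
  induction b with
  | nil => exact absurd rfl hb
  | cons a b ih =>
    cases b with
    | nil =>
      cases hw : runFact w with
      | nil => exact runFact_cons_nil a hw
      | cons r rs =>
        have : r.headI ≤ a := h r (by simp [hw])
        rw [List.singleton_append, runFact_cons_cons a hw, if_neg (by omega)]
    | cons a' b =>
      have haa : a < a' := List.rel_of_pairwise_cons hinc (by simp)
      have := ih (by simp) hinc.of_cons fun c hc => (h c hc).trans haa.le
      rw [List.cons_append, runFact_cons_cons a this, if_pos (by simpa using haa)]

theorem runFact_flatten {bs : List (List ℕ)} (hne : ∀ b ∈ bs, b ≠ [])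
    (hinc : ∀ b ∈ bs, b.Pairwise (· < ·)) (hh : (bs.map List.headI).Pairwise (· > ·)) :
    runFact bs.flatten = bs := by
  induction bs with
  | nil => rfl
  | cons b bs ih =>
    have hih := ih (fun c hc => hne c (by simp [hc])) (fun c hc => hinc c (by simp [hc]))
      hh.of_cons
    rw [List.flatten_cons, runFact_append (hne b (by simp)) (hinc b (by simp)), hih]
    intro c hc
    rw [hih] at hc
    exact (List.rel_of_pairwise_cons hh
      (List.mem_map_of_mem (List.mem_of_mem_head? hc))).le

theorem flatten_runFact (u : List ℕ) : (runFact u).flatten = u := by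
  induction u with
  | nil => rfl
  | cons a u ih =>
    cases hu : runFact u with
    | nil => rw [runFact_cons_nil a hu, ← ih, hu]; rfl
    | cons r rs =>
      rw [runFact_cons_cons a hu]
      split <;> simpa [hu] using ih

theorem runFact_spec (u : List ℕ) : ∀ b ∈ runFact u, b ≠ [] ∧ b.Pairwise (· < ·) := by
  induction u with
  | nil => simp [runFact]
  | cons a u ih =>
    cases hu : runFact u with
    | nil => rw [runFact_cons_nil a hu]; simp
    | cons r rs =>
      rw [hu] at ih
      rw [runFact_cons_cons a hu]
      split
      · rename_i har
        intro b hb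
        rcases List.mem_cons.1 hb with rfl | hb
        · obtain ⟨h1, h2⟩ := ih r (by simp)
          refine ⟨by simp, List.pairwise_cons.2 ⟨fun y hy => ?_, h2⟩⟩
          cases r with
          | nil => exact absurd rfl h1
          | cons c r =>
            have har : a < c := har
            rcases List.mem_cons.1 hy with rfl | hy
            · exact har
            · exact har.trans (List.rel_of_pairwise_cons h2 hy)
        · exact ih b (by simp [hb])
      · intro b hb
        rcases List.mem_cons.1 hb with rfl | hb
        · simp
        · exact ih b hb

theorem wdtRows_eq (bs : List (List ℕ)) : wdtRows bs = wdtRowsAux (bs.headI.headI + 1) bs := by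
  cases bs <;> simp [wdtRows, wdtRowsAux]

theorem length_wdtRowsAux (p : ℤ) (bs : List (List ℕ)) :
    (wdtRowsAux p bs).length = bs.length := by
  induction bs generalizing p with
  | nil => rfl
  | cons b bs ih => simp [wdtRowsAux, ih]

theorem wdtRowsAux_lt {p r : ℤ} {bs : List (List ℕ)} (hr : r ∈ wdtRowsAux p bs) : r < p := by
  induction bs generalizing p with
  | nil => simp [wdtRowsAux] at hr
  | cons b bs ih =>
    rw [wdtRowsAux, List.mem_cons] at hr
    rcases hr with rfl | hr
    · omega
    · have := ih hr; omega

theorem wdtRowsAux_pairwise (p : ℤ) (bs : List (List ℕ)) :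
    (wdtRowsAux p bs).Pairwise (· > ·) := by
  induction bs generalizing p with
  | nil => simp [wdtRowsAux]
  | cons b bs ih => exact List.pairwise_cons.2 ⟨fun r hr => wdtRowsAux_lt hr, ih _⟩

theorem wdtRowsAux_le_head {p : ℤ} {bs : List (List ℕ)} :
    ∀ q ∈ (wdtRowsAux p bs).zip bs, q.1 ≤ q.2.headI := by
  induction bs generalizing p with
  | nil => simp [wdtRowsAux]
  | cons b bs ih =>
    intro q hq
    rw [wdtRowsAux, List.zip_cons_cons, List.mem_cons] at hq
    rcases hq with rfl | hq
    · exact min_le_right _ _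
    · exact ih q hq

theorem wdtRowsAux_of_decreasing {p : ℤ} {bs : List (List ℕ)} (hp : ∀ b ∈ bs, (b.headI : ℤ) < p)
    (hh : (bs.map List.headI).Pairwise (· > ·)) :
    wdtRowsAux p bs = bs.map fun b => (b.headI : ℤ) := by
  induction bs generalizing p with
  | nil => rfl
  | cons b bs ih =>
    have hb := hp b (by simp)
    rw [wdtRowsAux, min_eq_right (by omega), List.map_cons, ih _ hh.of_cons]
    intro c hc
    exact_mod_cast List.rel_of_pairwise_cons hh (List.mem_map_of_mem hc)

theorem wdtRows_of_decreasing {bs : List (List ℕ)} (hh : (bs.map List.headI).Pairwise (· > ·)) :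
    wdtRows bs = bs.map fun b => (b.headI : ℤ) := by
  rw [wdtRows_eq]
  refine wdtRowsAux_of_decreasing (fun b hb => ?_) hh
  cases bs with
  | nil => simp at hb
  | cons c bs =>
    rcases List.mem_cons.1 hb with rfl | hb
    · simp
    · have : c.headI > b.headI := List.rel_of_pairwise_cons hh (List.mem_map_of_mem hb)
      simp only [List.headI_cons]
      omega

/-- The length of the row of index `r` in a list of indexed rows. -/
def lenRow (Z : List (ℤ × List ℕ)) (r : ℤ) : ℕ :=
  ((Z.find? fun p => decide (p.1 = r)).map fun p => p.2.length).getD 0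

theorem lenRow_nil (r : ℤ) : lenRow [] r = 0 := rfl

theorem lenRow_cons_self (p : ℤ × List ℕ) (Z : List (ℤ × List ℕ)) :
    lenRow (p :: Z) p.1 = p.2.length := by
  simp [lenRow]

theorem lenRow_cons_of_ne {p : ℤ × List ℕ} {r : ℤ} (h : p.1 ≠ r) (Z : List (ℤ × List ℕ)) :
    lenRow (p :: Z) r = lenRow Z r := by
  simp [lenRow, h]

theorem lenRow_eq_zero {r : ℤ} {Z : List (ℤ × List ℕ)} (h : ∀ p ∈ Z, p.1 ≠ r) :
    lenRow Z r = 0 := by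
  induction Z with
  | nil => rfl
  | cons p Z ih => rw [lenRow_cons_of_ne (h p (by simp)), ih fun q hq => h q (by simp [hq])]

theorem lenRow_eq {p : ℤ × List ℕ} {Z : List (ℤ × List ℕ)} (hp : p ∈ Z)
    (hZ : (Z.map Prod.fst).Pairwise (· > ·)) : lenRow Z p.1 = p.2.length := by
  induction Z with
  | nil => simp at hp
  | cons q Z ih =>
    rcases List.mem_cons.1 hp with rfl | hp
    · exact lenRow_cons_self _ _
    · have : q.1 > p.1 := List.rel_of_pairwise_cons hZ (List.mem_map_of_mem hp)
      rw [lenRow_cons_of_ne this.ne', ih hp hZ.of_cons]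

theorem sum_lenRow {k : ℕ} {Z : List (ℤ × List ℕ)} (hZ : (Z.map Prod.fst).Pairwise (· > ·))
    (hk : ∀ p ∈ Z, 1 ≤ p.1 ∧ p.1 ≤ k) :
    ∑ i ∈ Finset.Icc 1 k, lenRow Z i = (Z.map Prod.snd).flatten.length := by
  induction Z with
  | nil => simp [lenRow_nil]
  | cons p Z ih =>
    obtain ⟨h1, h2⟩ := hk p (by simp)
    have hmem : p.1.toNat ∈ Finset.Icc 1 k := Finset.mem_Icc.2 (by omega)
    have hcast : ((p.1.toNat : ℕ) : ℤ) = p.1 := by omega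
    have hz : lenRow Z p.1 = 0 := lenRow_eq_zero fun q hq =>
      (show p.1 > q.1 from List.rel_of_pairwise_cons hZ (List.mem_map_of_mem hq)).ne
    have hih := ih hZ.of_cons fun q hq => hk q (by simp [hq])
    rw [← Finset.add_sum_erase _ _ hmem, hcast] at hih ⊢
    rw [lenRow_cons_self]
    have : ∑ i ∈ (Finset.Icc 1 k).erase p.1.toNat, lenRow (p :: Z) i =
        ∑ i ∈ (Finset.Icc 1 k).erase p.1.toNat, lenRow Z i :=
      Finset.sum_congr rfl fun i hi => lenRow_cons_of_ne (by
        have := (Finset.mem_erase.1 hi).1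
        omega) _
    rw [this, List.map_cons, List.flatten_cons, List.length_append]
    omega

/-- The letters in the rows of index larger than `k` form a left factor. -/
theorem exists_split_rows (k : ℕ) {Z : List (ℤ × List ℕ)}
    (hZ : (Z.map Prod.fst).Pairwise (· > ·)) (hpos : ∀ p ∈ Z, 1 ≤ p.1)
    (hle : ∀ p ∈ Z, p.1 ≤ p.2.headI) (hinc : ∀ p ∈ Z, p.2.Pairwise (· < ·)) :
    ∃ v w, (Z.map Prod.snd).flatten = v ++ w ∧ (∀ x ∈ v, k < x) ∧
      w.length = ∑ i ∈ Finset.Icc 1 k, lenRow Z i := by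
  induction Z with
  | nil => exact ⟨[], [], by simp [lenRow_nil]⟩
  | cons p Z ih =>
    by_cases hpk : p.1 ≤ k
    · refine ⟨[], _, rfl, by simp, (sum_lenRow hZ fun q hq => ⟨hpos q hq, ?_⟩).symm⟩
      rcases List.mem_cons.1 hq with rfl | hq
      · exact hpk
      · have : p.1 > q.1 := List.rel_of_pairwise_cons hZ (List.mem_map_of_mem hq)
        omega
    · obtain ⟨v, w, h1, h2, h3⟩ := ih hZ.of_cons (fun q hq => hpos q (by simp [hq]))
        (fun q hq => hle q (by simp [hq])) (fun q hq => hinc q (by simp [hq]))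
      refine ⟨p.2 ++ v, w, by simp [h1], fun x hx => ?_, ?_⟩
      · rcases List.mem_append.1 hx with hx | hx
        · have hle' := hle p (by simp)
          have hinc' := hinc p (by simp)
          have : p.2.headI ≤ x := by
            cases hp : p.2 with
            | nil => simp [hp] at hx
            | cons a b =>
              rw [hp] at hx hinc'
              rcases List.mem_cons.1 hx with rfl | hx
              · exact le_rfl
              · exact (List.rel_of_pairwise_cons hinc' hx).le
          omega
        · exact h2 x hx
      · rw [h3]
        refine Finset.sum_congr rfl fun i hi => (lenRow_cons_of_ne ?_ _).symm
        have := (Finset.mem_Icc.1 hi).2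
        omega

/-- The indexed rows of the weak descent tableau. -/
def wdtPairs (u : List ℕ) : List (ℤ × List ℕ) := (wdtRows (runFact u)).zip (runFact u)

theorem map_fst_wdtPairs (u : List ℕ) : (wdtPairs u).map Prod.fst = wdtRows (runFact u) :=
  List.map_fst_zip (by rw [wdtRows_eq, length_wdtRowsAux])

theorem map_snd_wdtPairs (u : List ℕ) : (wdtPairs u).map Prod.snd = runFact u :=
  List.map_snd_zip (by rw [wdtRows_eq, length_wdtRowsAux])

theorem wdtPairs_pairwise (u : List ℕ) : ((wdtPairs u).map Prod.fst).Pairwise (· > ·) := by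
  rw [map_fst_wdtPairs, wdtRows_eq]
  exact wdtRowsAux_pairwise _ _

theorem weakDesTab_ne_zero {u : List ℕ} (hu : PosWord u) {r : ℤ} {c : ℕ} :
    weakDesTab u r c ≠ 0 ↔ 1 ≤ c ∧ c ≤ lenRow (wdtPairs u) r := by
  rw [weakDesTab, lenRow, wdtPairs]
  by_cases hc : c = 0
  · simp [hc]
  rw [if_neg hc]
  cases h : ((wdtRows (runFact u)).zip (runFact u)).find? (fun p => decide (p.1 = r)) with
  | none => simp; omega
  | some p =>
    have hp : p.2 ∈ runFact u := (List.of_mem_zip (List.mem_of_find?_eq_some h)).2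
    simp only [Option.map_some, Option.getD_some]
    by_cases hlt : c - 1 < p.2.length
    · rw [List.getD_eq_getElem _ _ hlt]
      have := hu p.2[c - 1] (by
        rw [← flatten_runFact u]
        exact List.mem_flatten.2 ⟨_, hp, List.getElem_mem hlt⟩)
      omega
    · rw [List.getD_eq_default _ _ (by omega)]
      omega

theorem desComp_eq {u : List ℕ} (hu : PosWord u) (i : ℕ) :
    desComp u i = lenRow (wdtPairs u) i := by
  rw [desComp, shapeOf]
  simp_rw [weakDesTab_ne_zero hu]
  rw [show {c | 1 ≤ c ∧ c ≤ lenRow (wdtPairs u) i} = Set.Icc 1 (lenRow (wdtPairs u) i) from rfl]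
  simp [Set.ncard_eq_toFinset_card']

theorem headI_natWord {b : List ℤ} (hb : b ≠ []) (hpos : ∀ x ∈ b, 1 ≤ x) :
    ((natWord b).headI : ℤ) = b.headI := by
  cases b with
  | nil => exact absurd rfl hb
  | cons a b =>
    have := hpos a (by simp)
    simp [natWord]
    omega

theorem cnt_eq_zero_of_nonpos {u : List ℕ} (hu : IsReducedWord u) {r : ℤ} (hr : r ≤ 0) :
    cnt r (intWord u) = 0 :=
  cnt_eq_zero_of_notMem hu.red fun h => by have := hu.1.one_le r h; omega

/-- Every class contains a word whose weak descent tableau has the shape of the left key. -/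
theorem exists_lenRow_eq_cnt {u : List ℕ} (hu : IsReducedWord u) :
    ∃ κ, CKEquiv u κ ∧ NonVirtual κ ∧ ∀ r, lenRow (wdtPairs κ) r = cnt r (intWord u) := by
  obtain ⟨bs, hck, hb⟩ := exists_isRows hu.red
  have hpos : ∀ b ∈ bs, ∀ x ∈ b, 1 ≤ x := fun b hbs x hx =>
    hu.1.one_le x ((hck.mem_iff x).2 (List.mem_flatten.2 ⟨b, hbs, hx⟩))
  have hhead : ∀ b ∈ bs, ((natWord b).headI : ℤ) = b.headI := fun b hbs =>
    headI_natWord (hb.ne_nil b hbs) (hpos b hbs)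
  have hmono : ((bs.map natWord).map List.headI).Pairwise (· > ·) := by
    have h := hb.heads
    rw [List.pairwise_map] at h
    rw [List.pairwise_map, List.pairwise_map]
    refine h.imp_of_mem fun {a b} ha hb' hab => ?_
    have := hhead a ha
    have := hhead b hb'
    omega
  have hrun : runFact (bs.map natWord).flatten = bs.map natWord := by
    refine runFact_flatten ?_ ?_ hmono
    · intro b hbs
      obtain ⟨a, ha, rfl⟩ := List.mem_map.1 hbs
      simpa [natWord] using hb.ne_nil a ha
    · intro b hbs
      obtain ⟨a, ha, rfl⟩ := List.mem_map.1 hbs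
      rw [natWord, List.pairwise_map]
      refine (hb.increasing a ha).imp_of_mem fun {x y} hx hy hxy => ?_
      have := hpos a ha x hx
      omega
  have hrows : wdtRows (bs.map natWord) = bs.map List.headI := by
    rw [wdtRows_of_decreasing hmono, List.map_map]
    exact List.map_congr_left hhead
  have hpair : wdtPairs (bs.map natWord).flatten = bs.map fun b => (b.headI, natWord b) := by
    rw [wdtPairs, hrun, hrows, List.zip_map']
  refine ⟨(bs.map natWord).flatten, ?_, ?_, fun r => ?_⟩
  · have := ckEquiv_natWord hck hu.1.one_le
    rwa [natWord_intWord, natWord, List.map_flatten] at this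
  · intro r hr
    rw [hrun, hrows] at hr
    obtain ⟨b, hbs, rfl⟩ := List.mem_map.1 hr
    have := hb.ne_nil b hbs
    cases b with
    | nil => exact absurd rfl this
    | cons a b => exact hpos _ hbs a (by simp)
  · by_cases hr : ∃ b ∈ bs, b.headI = r
    · obtain ⟨b, hbs, rfl⟩ := hr
      have hmem : (b.headI, natWord b) ∈ wdtPairs (bs.map natWord).flatten := by
        rw [hpair]
        exact List.mem_map_of_mem hbs
      rw [lenRow_eq hmem (wdtPairs_pairwise _), natWord, List.length_map]
      exact hb.length_eq b hbs
    · have h0 : cnt r (intWord u) = 0 := by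
        by_contra h0
        exact hr (hb.exists_row r h0)
      rw [h0, hpair]
      refine lenRow_eq_zero fun p hp e => hr ?_
      obtain ⟨b, hbs, rfl⟩ := List.mem_map.1 hp
      exact ⟨b, hbs, e⟩

theorem sum_cnt_le {u σ : List ℕ} (hu : IsReducedWord u) (h : CKEquiv u σ) (hσ : NonVirtual σ)
    (k : ℕ) :
    ∑ i ∈ Finset.Icc 1 k, cnt i (intWord u) ≤ ∑ i ∈ Finset.Icc 1 k, lenRow (wdtPairs σ) i := by
  obtain ⟨v, w, hvw, hv, hw⟩ := exists_split_rows k (wdtPairs_pairwise σ)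
    (fun p hp => hσ _ (List.of_mem_zip hp).1)
    (fun p hp => wdtRowsAux_le_head p (by rwa [← wdtRows_eq]))
    (fun p hp => (runFact_spec σ _ (List.of_mem_zip hp).2).2)
  rw [map_snd_wdtPairs, flatten_runFact] at hvw
  rw [← hw]
  have hck := h.ck
  have hlen := hck.length_eq
  rw [hvw, intWord_append] at hck
  have hmem : ∀ x ∈ u, x ≤ u.sum + k := fun x hx => by
    have := List.le_sum_of_mem hx
    omega
  have h1 := length_left_le (S := (Finset.Ioc k (u.sum + k)).map Nat.castEmbedding) hu.red hck
    fun x hx => by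
      have hxu := (hck.mem_iff x).2 (List.mem_append_left _ hx)
      obtain ⟨y, hy, rfl⟩ := List.mem_map.1 hxu
      obtain ⟨z, hz, hzy⟩ := List.mem_map.1 hx
      have hzy : z = y := by exact_mod_cast hzy
      exact Finset.mem_map_of_mem _ (Finset.mem_Ioc.2 ⟨hzy ▸ hv z hz, hmem y hy⟩)
  have h2 := sum_cnt (S := (Finset.Ioc 0 (u.sum + k)).map Nat.castEmbedding) hu.red
    fun x hx => by
      obtain ⟨y, hy, rfl⟩ := List.mem_map.1 hx
      exact Finset.mem_map_of_mem _ (Finset.mem_Ioc.2 ⟨hu.1 y hy, hmem y hy⟩)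
  rw [Finset.sum_map] at h1 h2
  rw [← Finset.sum_Ioc_consecutive _ (Nat.zero_le k) (Nat.le_add_left k u.sum)] at h2
  simp only [Nat.castEmbedding_apply] at h1 h2
  rw [hlen, hvw] at h2
  simp only [intWord, List.length_map, List.length_append] at h1 h2
  change ∑ i ∈ Finset.Ioc 0 k, cnt i (intWord u) ≤ _
  simp only [intWord]
  omega

theorem Yamanouchi.lenRow_eq {u σ : List ℕ} (hu : IsReducedWord u) (hσ : Yamanouchi σ)
    (h : CKEquiv u σ) (r : ℤ) : lenRow (wdtPairs σ) r = cnt r (intWord u) := by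
  obtain ⟨hred, hnv, hmin⟩ := hσ
  obtain ⟨κ, hκ, hκnv, hlen⟩ := exists_lenRow_eq_cnt hu
  by_cases hr : 1 ≤ r
  · have hsum : ∀ k : ℕ, ∑ i ∈ Finset.Icc 1 k, lenRow (wdtPairs σ) i =
        ∑ i ∈ Finset.Icc 1 k, cnt i (intWord u) := fun k => by
      refine le_antisymm ?_ (sum_cnt_le hu h hnv k)
      have := hmin κ hκnv (.trans _ _ _ (.symm _ _ h) hκ) k
      simpa only [desComp_eq hred.1, desComp_eq (hu.congr hκ).1, hlen] using this
    obtain ⟨k, rfl⟩ : ∃ k : ℕ, r = (k + 1 : ℕ) := ⟨(r - 1).toNat, by omega⟩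
    have h1 := hsum (k + 1)
    rw [Finset.sum_Icc_succ_top (by omega), Finset.sum_Icc_succ_top (by omega), hsum k] at h1
    exact Nat.add_left_cancel h1
  · rw [cnt_eq_zero_of_nonpos hu (by omega)]
    refine lenRow_eq_zero fun p hp e => hr ?_
    rw [← e]
    exact hnv _ (List.of_mem_zip hp).1

theorem exists_yamanouchi {u : List ℕ} (hu : IsReducedWord u) :
    ∃ σ, Yamanouchi σ ∧ CKEquiv u σ := by
  obtain ⟨κ, hκ, hκnv, hlen⟩ := exists_lenRow_eq_cnt hu
  have hr := hu.congr hκ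
  refine ⟨κ, ⟨hr, hκnv, fun σ hσ h k => ?_⟩, hκ⟩
  have := sum_cnt_le hu (.trans _ _ _ hκ h) hσ k
  simpa only [desComp_eq hr.1, desComp_eq (hr.congr h).1, hlen] using this

/-- The boxes of column `c` of the weak insertion tableau are in the rows recorded by the
corresponding column of the left key. -/
theorem hatP_ne_zero {u : List ℕ} (hu : IsReducedWord u) {r : ℤ} {c : ℕ} :
    hatP u r c ≠ 0 ↔ 1 ≤ c ∧ r ∈ keyCol (c - 1) (intWord u) := by
  have h := exists_yamanouchi hu
  have hρ : Yamanouchi (hatRho u) ∧ CKEquiv u (hatRho u) := by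
    rw [hatRho, dif_pos h]
    exact h.choose_spec
  rw [hatP, weakDesTab_ne_zero hρ.1.1.1, hρ.1.lenRow_eq hu hρ.2, mem_keyCol_iff hu.red]
  omega

theorem col_of_hatP {u : List ℕ} {x : ℕ} (h : IsReducedWord (u ++ [x])) {r : ℤ} {c : ℕ}
    (hc : hatP (u ++ [x]) r c ≠ 0 ∧ hatP u r c = 0) :
    1 ≤ c ∧ Col (c - 1) (intWord u) x := by
  obtain ⟨h1, h2⟩ := (hatP_ne_zero h).1 hc.1
  have h3 : r ∉ keyCol (c - 1) (intWord u) := fun h3 =>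
    (hatP_ne_zero h.left).2 ⟨h1, h3⟩ hc.2
  refine ⟨h1, col_of_keyCol_ne ?_ fun e => h3 ?_⟩
  · simpa [intWord] using h.red
  · rw [← e]
    simpa [intWord] using h2

/-- Lemma `corollary 331`.
Suppose `ρ` is a reduced word and `ρxy` is also reduced.  If the box of
`P̂(ρx) \ P̂(ρ)` is in column `c_x` and the box of `P̂(ρxy) \ P̂(ρx)` is in column `c_y`,
then `x < y` if and only if `c_x < c_y`. -/
theorem hatP_column_descents (ρ : List ℕ) (x y : ℕ) (hx : 1 ≤ x) (hy : 1 ≤ y)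
    (hρ : IsReducedWord ρ) (hρxy : IsReducedWord (ρ ++ [x, y]))
    (rx ry : ℤ) (cx cy : ℕ)
    (hbx : hatP (ρ ++ [x]) rx cx ≠ 0 ∧ hatP ρ rx cx = 0)
    (hby : hatP (ρ ++ [x, y]) ry cy ≠ 0 ∧ hatP (ρ ++ [x]) ry cy = 0) :
    x < y ↔ cx < cy := by
  have hsplit : ρ ++ [x, y] = ρ ++ [x] ++ [y] := by simp
  rw [hsplit] at hby
  have hxy : IsReducedWord (ρ ++ [x] ++ [y]) := hsplit ▸ hρxy
  obtain ⟨h1, hcx⟩ := col_of_hatP hxy.left hbx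
  obtain ⟨h2, hcy⟩ := col_of_hatP hxy hby
  rw [show intWord (ρ ++ [x]) = intWord ρ ++ [(x : ℤ)] by simp [intWord]] at hcy
  constructor
  · intro h
    have := hcx.lt_of_lt hcy (by exact_mod_cast h)
    omega
  · intro h
    by_contra hlt
    have hne : (x : ℤ) ≠ y := Red.ne (u := intWord ρ) (by simpa [intWord] using hρxy.red)
    have := hcx.le_of_lt hcy (by omega)
    omega

end
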